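/- arXiv:2509.06935 — 2 statements merged into one kernel-verified Lean document; each statement's English description precedes it below -/
import Mathlib

section
/- There exists a constant c > 0 such that for every integer d ≥ 3 there exist a constant C > 0 and N ∈ ℕ with the following property: for all n ≥ N, the number S(n,d) of ordered (d+2)-tuples of points of [n]^d all of whose entries lie on a common (d−1)-sphere in ℝ^d satisfies S(n,d) ≤ C · (n^{d^2 + 2d − 4 + c/log log n} + n^{d^2 + d} · log n). -/
/-- The grid `[n]^d`: points of `ℝ^d` with all coordinates integers in `{1, …, n}`. -/
def grid (d n : ℕ) : Set (EuclideanSpace ℝ (Fin d)) :=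
  {x | ∀ i, ∃ m : ℕ, 1 ≤ m ∧ m ≤ n ∧ x i = (m : ℝ)}

/-- `S(n,d)`: the number of ordered `(d+2)`-tuples of points of `[n]^d` all of whose entries
lie on a common `(d-1)`-sphere in `ℝ^d`. -/
noncomputable def conSphericalCount (n d : ℕ) : ℕ :=
  {t : Fin (d + 2) → EuclideanSpace ℝ (Fin d) | (∀ i, t i ∈ grid d n) ∧
    ∃ (c : EuclideanSpace ℝ (Fin d)) (ρ : ℝ), 0 < ρ ∧ ∀ i, t i ∈ Metric.sphere c ρ}.ncard


theorem prim_rep_key {α β m x y u v : ℤ} (hαm : IsCoprime α m) (hβm : IsCoprime β m)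
    (h1 : α * x ^ 2 + β * y ^ 2 = m) (h2 : α * u ^ 2 + β * v ^ 2 = m)
    (hxy : IsCoprime x y) (huv : IsCoprime u v) :
    m ∣ (Int.gcd m (x * v - u * y) : ℤ) * (Int.gcd m (x * v + u * y) : ℤ) ∧
      (Int.gcd (Int.gcd m (x * v - u * y) : ℤ) (Int.gcd m (x * v + u * y) : ℤ)) ∣ 2 := by
  constructor
  · have h : m ∣ (x * v - u * y) * (x * v + u * y) := by
      apply hαm.symm.dvd_of_dvd_mul_left
      exact ⟨v ^ 2 - y ^ 2, by linear_combination v ^ 2 * h1 - y ^ 2 * h2⟩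
    have h3 : m ∣ gcd m ((x * v - u * y) * (x * v + u * y)) := dvd_gcd dvd_rfl h
    exact h3.trans (gcd_mul_dvd_mul_gcd _ _ _)
  · set g := Int.gcd (Int.gcd m (x * v - u * y) : ℤ) (Int.gcd m (x * v + u * y) : ℤ) with hg
    have hga : (g : ℤ) ∣ Int.gcd m (x * v - u * y) := Int.gcd_dvd_left ..
    have hgb : (g : ℤ) ∣ Int.gcd m (x * v + u * y) := Int.gcd_dvd_right ..
    have hgm : (g : ℤ) ∣ m := hga.trans (Int.gcd_dvd_left ..)
    have hg1 : (g : ℤ) ∣ x * v - u * y := hga.trans (Int.gcd_dvd_right ..)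
    have hg2 : (g : ℤ) ∣ x * v + u * y := hgb.trans (Int.gcd_dvd_right ..)
    have hxv : (g : ℤ) ∣ 2 * (x * v) := by
      have := dvd_add hg1 hg2; ring_nf at this ⊢; exact this
    have huy : (g : ℤ) ∣ 2 * (u * y) := by
      have := dvd_sub hg2 hg1; ring_nf at this ⊢; exact this
    -- general: x and y are each coprime to m
    have cop : ∀ {a b : ℤ}, α * a ^ 2 + β * b ^ 2 = m → IsCoprime a b → IsCoprime a m := by
      intro a b hab hc
      have : IsCoprime a (β * b ^ 2) := by
        apply IsCoprime.mul_right _ hc.pow_right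
        rw [Int.isCoprime_iff_gcd_eq_one] 
        by_contra hne
        obtain ⟨p, hp, hpd⟩ := Nat.exists_prime_and_dvd hne
        have hpa : (p : ℤ) ∣ a := (Int.natCast_dvd_natCast.2 hpd).trans (Int.gcd_dvd_left ..)
        have hpb : (p : ℤ) ∣ β := (Int.natCast_dvd_natCast.2 hpd).trans (Int.gcd_dvd_right ..)
        have hpm : (p : ℤ) ∣ m := by
          rw [← hab]; exact dvd_add ((dvd_pow hpa two_ne_zero).mul_left _) (hpb.mul_right _)
        have := hβm.isUnit_of_dvd' hpb hpm
        exact (Nat.prime_iff_prime_int.1 hp).not_isUnit this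
      have h3 : IsCoprime a (β * b ^ 2 + a * (α * a)) := this.add_mul_left_right _
      convert h3 using 1
      rw [← hab]; ring
    have cx : IsCoprime x m := cop h1 hxy
    have cu : IsCoprime u m := cop h2 huv
    have cop' : ∀ {a b : ℤ}, α * a ^ 2 + β * b ^ 2 = m → IsCoprime a b → IsCoprime a m → IsCoprime b m := by
      intro a b hab hc ham
      rw [Int.isCoprime_iff_gcd_eq_one]
      by_contra hne
      obtain ⟨p, hp, hpd⟩ := Nat.exists_prime_and_dvd hne
      have hpb : (p : ℤ) ∣ b := (Int.natCast_dvd_natCast.2 hpd).trans (Int.gcd_dvd_left ..)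
      have hpm : (p : ℤ) ∣ m := (Int.natCast_dvd_natCast.2 hpd).trans (Int.gcd_dvd_right ..)
      have hpp := Nat.prime_iff_prime_int.1 hp
      have : (p : ℤ) ∣ α * a ^ 2 := by
        have := dvd_sub hpm ((dvd_pow hpb two_ne_zero).mul_left β)
        rwa [← hab, add_sub_cancel_right] at this
      rcases hpp.dvd_or_dvd this with h | h
      · exact hpp.not_isUnit (hαm.isUnit_of_dvd' h hpm)
      · exact hpp.not_isUnit (ham.isUnit_of_dvd' (hpp.dvd_of_dvd_pow h) hpm)
    have cv : IsCoprime v m := cop' h2 huv cu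
    have : IsCoprime (g : ℤ) (x * v) :=
      (IsCoprime.of_isCoprime_of_dvd_right (IsCoprime.mul_left cx cv) hgm).symm
    have h2 := this.dvd_of_dvd_mul_right hxv
    exact_mod_cast h2

open Finset in
theorem prim_rep_bound {α β m : ℤ} (hα : 0 < α) (hβ : 0 < β) (hm : 0 < m)
    (hαm : IsCoprime α m) (hβm : IsCoprime β m)
    (A : Finset (ℤ × ℤ)) (hA : ∀ z ∈ A, α * z.1 ^ 2 + β * z.2 ^ 2 = m ∧ IsCoprime z.1 z.2) :
    #A ≤ 10 * (#m.natAbs.divisors) ^ 2 := by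
  rcases A.eq_empty_or_nonempty with rfl | ⟨⟨u, v⟩, huv⟩
  · simp
  obtain ⟨h2, huvc⟩ := hA _ huv
  simp only at h2 huvc
  have hT : #(m.natAbs.divisors ×ˢ m.natAbs.divisors) = (#m.natAbs.divisors) ^ 2 := by
    rw [card_product, sq]
  rw [← hT]
  have hmn : m.natAbs ≠ 0 := by omega
  refine card_le_mul_card_image_of_maps_to
    (f := fun z : ℤ × ℤ => (Int.gcd m (z.1 * v - u * z.2), Int.gcd m (z.1 * v + u * z.2))) ?_ 10 ?_
  · intro z hz
    simp only [mem_product, Nat.mem_divisors]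
    exact ⟨⟨Int.gcd_dvd_natAbs_left .., hmn⟩, ⟨Int.gcd_dvd_natAbs_left .., hmn⟩⟩
  · rintro ⟨a, b⟩ -
    set B := A.filter (fun z : ℤ × ℤ => (Int.gcd m (z.1 * v - u * z.2), Int.gcd m (z.1 * v + u * z.2)) = (a, b)) with hB
    rcases B.eq_empty_or_nonempty with h0 | ⟨⟨x', y'⟩, hz'⟩
    · rw [h0]; simp
    rw [hB, mem_filter] at hz'
    obtain ⟨hz'A, hz'ab⟩ := hz'
    obtain ⟨h1', hc'⟩ := hA _ hz'A
    simp only [Prod.mk.injEq] at h1' hc' hz'ab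
    have key : ∀ z ∈ B, ∃ k ∈ Icc (-2 : ℤ) 2, 2 * (z.1 * y' - x' * z.2) = m * k := by
      rintro ⟨x, y⟩ hz
      rw [hB, mem_filter] at hz
      obtain ⟨hzA, hzab⟩ := hz
      obtain ⟨h1, hc⟩ := hA _ hzA
      simp only [Prod.mk.injEq] at h1 hc hzab ⊢
      obtain ⟨k1, k2⟩ := prim_rep_key hαm hβm h1 h2 hc huvc
      rw [hzab.1, hzab.2] at k1 k2
      have ea : (a : ℤ) ∣ x * v - u * y := by rw [← hzab.1]; exact Int.gcd_dvd_right ..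
      have eb : (b : ℤ) ∣ x * v + u * y := by rw [← hzab.2]; exact Int.gcd_dvd_right ..
      have ea' : (a : ℤ) ∣ x' * v - u * y' := by rw [← hz'ab.1]; exact Int.gcd_dvd_right ..
      have eb' : (b : ℤ) ∣ x' * v + u * y' := by rw [← hz'ab.2]; exact Int.gcd_dvd_right ..
      obtain ⟨s, t, hst⟩ := huvc
      have fa : (a : ℤ) ∣ x * y' - x' * y := by
        have h3 : (a : ℤ) ∣ u * (x * y' - x' * y) := by
          have := dvd_sub (ea.mul_left x') (ea'.mul_left x)
          have e : ∀ p : ℤ, p = u * (x * y' - x' * y) → (a : ℤ) ∣ p → (a : ℤ) ∣ u * (x * y' - x' * y) :=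
            fun p hp h => hp ▸ h
          exact e _ (by ring) this
        have h4 : (a : ℤ) ∣ v * (x * y' - x' * y) := by
          have := dvd_sub (ea.mul_left y') (ea'.mul_left y)
          have e : ∀ p : ℤ, p = v * (x * y' - x' * y) → (a : ℤ) ∣ p → (a : ℤ) ∣ v * (x * y' - x' * y) :=
            fun p hp h => hp ▸ h
          exact e _ (by ring) this
        have := dvd_add (h3.mul_left s) (h4.mul_left t)
        have e : ∀ p : ℤ, p = (x * y' - x' * y) → (a : ℤ) ∣ p → (a : ℤ) ∣ (x * y' - x' * y) :=
            fun p hp h => hp ▸ h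
        exact e _ (by linear_combination (x * y' - x' * y) * hst) this
      have fb : (b : ℤ) ∣ x * y' - x' * y := by
        have e : ∀ p r : ℤ, p = r → (b : ℤ) ∣ p → (b : ℤ) ∣ r := fun p r hp h => hp ▸ h
        have h3 : (b : ℤ) ∣ u * (x * y' - x' * y) :=
          e _ _ (by ring) (dvd_sub (eb'.mul_left x) (eb.mul_left x'))
        have h4 : (b : ℤ) ∣ v * (x * y' - x' * y) :=
          e _ _ (by ring) (dvd_sub (eb.mul_left y') (eb'.mul_left y))
        exact e _ _ (by linear_combination (x * y' - x' * y) * hst)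
          (dvd_add (h3.mul_left s) (h4.mul_left t))
      have hl : (Int.lcm a b : ℤ) ∣ x * y' - x' * y := Int.coe_lcm_dvd fa fb
      have hmd : m ∣ 2 * (x * y' - x' * y) := by
        refine k1.trans ?_
        have e1 : ((a : ℤ) * b) = (Int.gcd a b : ℤ) * (Int.lcm a b : ℤ) := by
          have := Nat.gcd_mul_lcm a b
          simp only [Int.gcd_natCast_natCast, Int.lcm, Int.natAbs_natCast]
          exact_mod_cast this.symm
        rw [e1]
        exact mul_dvd_mul (by exact_mod_cast k2) hl
      obtain ⟨k, hk⟩ := hmd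
      refine ⟨k, ?_, hk⟩
      have hid : (α * x * x' + β * y * y') ^ 2 + α * β * (x * y' - x' * y) ^ 2 = m ^ 2 := by
        have : (α * x ^ 2 + β * y ^ 2) * (α * x' ^ 2 + β * y' ^ 2) = m ^ 2 := by rw [h1, h1']; ring
        rw [← this]; ring
      have hW : (x * y' - x' * y) ^ 2 ≤ m ^ 2 := by
        have : 1 ≤ α * β := by nlinarith
        nlinarith [sq_nonneg (x * y' - x' * y), sq_nonneg (α * x * x' + β * y * y')]
      have hW' := abs_le_of_sq_le_sq' hW hm.le
      rw [mem_Icc]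
      constructor
      · nlinarith
      · nlinarith
    choose! kf hk1 hk2 using key
    have : #B ≤ #((Icc (-2 : ℤ) 2) ×ˢ (univ : Finset Bool)) := by
      refine card_le_card_of_injOn (fun z => (kf z, decide (0 ≤ α * z.1 * x' + β * z.2 * y'))) ?_ ?_
      · intro z hz
        simp only [coe_product, Set.mem_prod, mem_coe]
        exact ⟨hk1 z hz, mem_univ _⟩
      · rintro ⟨x, y⟩ hz ⟨x2, y2⟩ hz2 heq
        simp only [Prod.mk.injEq, decide_eq_decide] at heq
        have w1 := hk2 _ hz
        have w2 := hk2 _ hz2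
        rw [heq.1] at w1
        simp only at w1 w2
        have hW : x * y' - x' * y = x2 * y' - x' * y2 := by linarith
        have hAz := hA _ (mem_filter.1 hz).1
        have hAz2 := hA _ (mem_filter.1 hz2).1
        simp only at hAz hAz2
        have hZ2 : (α * x * x' + β * y * y') ^ 2 = (α * x2 * x' + β * y2 * y') ^ 2 := by
          have e1 : (α * x * x' + β * y * y') ^ 2 + α * β * (x * y' - x' * y) ^ 2 = m ^ 2 := by
            have : (α * x ^ 2 + β * y ^ 2) * (α * x' ^ 2 + β * y' ^ 2) = m ^ 2 := by
              rw [hAz.1, h1']; ring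
            rw [← this]; ring
          have e2 : (α * x2 * x' + β * y2 * y') ^ 2 + α * β * (x2 * y' - x' * y2) ^ 2 = m ^ 2 := by
            have : (α * x2 ^ 2 + β * y2 ^ 2) * (α * x' ^ 2 + β * y' ^ 2) = m ^ 2 := by
              rw [hAz2.1, h1']; ring
            rw [← this]; ring
          rw [hW] at e1; linarith
        have hZ : α * x * x' + β * y * y' = α * x2 * x' + β * y2 * y' := by
          rcases sq_eq_sq_iff_eq_or_eq_neg.1 hZ2 with h | h
          · exact h
          · by_cases hp : 0 ≤ α * x * x' + β * y * y'
            · have := heq.2.1 hp; omega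
            · have : ¬ 0 ≤ α * x2 * x' + β * y2 * y' := fun h => hp (heq.2.2 h)
              omega
        have hx : m * x = m * x2 := by
          rw [← h1']; linear_combination x' * hZ + β * y' * hW
        have hy : m * y = m * y2 := by
          rw [← h1']; linear_combination y' * hZ - α * x' * hW
        rw [Prod.mk.injEq]
        exact ⟨mul_left_cancel₀ hm.ne' hx, mul_left_cancel₀ hm.ne' hy⟩
    simpa using this

open Finset in
theorem card_divisors_mono {a b : ℕ} (h : a ∣ b) (hb : b ≠ 0) : #a.divisors ≤ #b.divisors :=
  card_le_card (Nat.divisors_subset_of_dvd hb h)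

open Finset in
theorem rep_bound : ∀ (m : ℕ), 0 < m → ∀ (α β : ℤ), 0 < α → 0 < β →
    ∀ (A : Finset (ℤ × ℤ)), (∀ z ∈ A, α * z.1 ^ 2 + β * z.2 ^ 2 = m) →
    #A ≤ 10 * (#m.divisors) ^ 3 := by
  intro m
  induction m using Nat.strong_induction_on with
  | _ m ih =>
  intro hm α β hα hβ A hA
  -- the reduction step at a prime dividing `β` and `m`
  have red : ∀ (α β : ℤ), 0 < α → 0 < β → ∀ (A : Finset (ℤ × ℤ)),
      (∀ z ∈ A, α * z.1 ^ 2 + β * z.2 ^ 2 = m) → ¬ IsCoprime β m → #A ≤ 10 * (#m.divisors) ^ 3 := by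
    intro α β hα hβ A hA hc
    rw [Int.isCoprime_iff_gcd_eq_one] at hc
    obtain ⟨p, hp, hpd⟩ := Nat.exists_prime_and_dvd hc
    have hpβ : (p : ℤ) ∣ β := (Int.natCast_dvd_natCast.2 hpd).trans (Int.gcd_dvd_left ..)
    have hpm' : (p : ℤ) ∣ m := (Int.natCast_dvd_natCast.2 hpd).trans (Int.gcd_dvd_right ..)
    have hpm : p ∣ m := by exact_mod_cast hpm'
    have hpp := Nat.prime_iff_prime_int.1 hp
    have hp0 : (0 : ℤ) < p := by exact_mod_cast hp.pos
    obtain ⟨m', rfl⟩ := hpm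
    obtain ⟨β', rfl⟩ := hpβ
    have hm' : 0 < m' := Nat.pos_of_mul_pos_left hm
    have hβ' : 0 < β' := by nlinarith
    have hlt : m' < p * m' := by nlinarith [hp.two_le]
    have hmono : 10 * (#m'.divisors) ^ 3 ≤ 10 * (#(p * m').divisors) ^ 3 := by
      have := card_divisors_mono (dvd_mul_left m' p) hm.ne'
      exact Nat.mul_le_mul_left _ (Nat.pow_le_pow_left this _)
    refine le_trans ?_ hmono
    by_cases hpα : (p : ℤ) ∣ α
    · obtain ⟨α', rfl⟩ := hpα
      have hα' : 0 < α' := by nlinarith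
      refine ih m' hlt hm' α' β' hα' hβ' A ?_
      intro z hz
      have := hA z hz
      push_cast at this
      apply mul_left_cancel₀ hp0.ne'
      linear_combination this
    · have hx : ∀ z ∈ A, (p : ℤ) ∣ z.1 := by
        intro z hz
        have h := hA z hz
        have : (p : ℤ) ∣ α * z.1 ^ 2 := ⟨m' - β' * z.2 ^ 2, by push_cast at h; linear_combination h⟩
        rcases hpp.dvd_or_dvd this with h | h
        · exact absurd h hpα
        · exact hpp.dvd_of_dvd_pow h
      have hinj : Set.InjOn (fun z : ℤ × ℤ => (z.1 / p, z.2)) (A : Set (ℤ × ℤ)) := by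
        rintro ⟨x, y⟩ h1 ⟨x2, y2⟩ h2 heq
        simp only [Prod.mk.injEq] at heq ⊢
        refine ⟨?_, heq.2⟩
        have e1 := Int.mul_ediv_cancel' (hx _ h1)
        have e2 := Int.mul_ediv_cancel' (hx _ h2)
        simp only at e1 e2
        rw [← e1, ← e2, heq.1]
      rw [← card_image_of_injOn hinj]
      refine ih m' hlt hm' (α * p) β' (by positivity) hβ' _ ?_
      intro w hw
      obtain ⟨z, hz, rfl⟩ := mem_image.1 hw
      obtain ⟨k, hk⟩ := hx z hz
      have h := hA z hz
      simp only
      rw [hk, Int.mul_ediv_cancel_left _ hp0.ne']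
      rw [hk] at h
      push_cast at h
      apply mul_left_cancel₀ hp0.ne'
      linear_combination h
  by_cases hβm : IsCoprime β (m : ℤ)
  swap
  · exact red α β hα hβ A hA hβm
  by_cases hαm : IsCoprime α (m : ℤ)
  swap
  · have hinj : Set.InjOn (Prod.swap : ℤ × ℤ → ℤ × ℤ) (A : Set (ℤ × ℤ)) :=
      Prod.swap_injective.injOn
    rw [← card_image_of_injOn hinj]
    refine red β α hβ hα _ ?_ hαm
    intro w hw
    obtain ⟨z, hz, rfl⟩ := mem_image.1 hw
    have := hA z hz
    simp only [Prod.fst_swap, Prod.snd_swap]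
    linarith
  have h3 : 10 * (#m.divisors) ^ 3 = (10 * (#m.divisors) ^ 2) * #m.divisors := by ring
  rw [h3]
  have hg : ∀ z ∈ A, (Int.gcd z.1 z.2 : ℤ) ^ 2 ∣ (m : ℤ) := by
    intro z hz
    rw [← hA z hz]
    exact dvd_add ((pow_dvd_pow_of_dvd (Int.gcd_dvd_left ..) 2).mul_left _)
      ((pow_dvd_pow_of_dvd (Int.gcd_dvd_right ..) 2).mul_left _)
  refine card_le_mul_card_image_of_maps_to (f := fun z : ℤ × ℤ => Int.gcd z.1 z.2) ?_ _ ?_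
  · intro z hz
    rw [Nat.mem_divisors]
    refine ⟨?_, hm.ne'⟩
    have := (Dvd.intro_left _ (by rw [sq] : (Int.gcd z.1 z.2 : ℤ) * (Int.gcd z.1 z.2 : ℤ) = _)).trans (hg z hz)
    exact_mod_cast this
  · intro g hgd
    set B := A.filter (fun z : ℤ × ℤ => Int.gcd z.1 z.2 = g) with hB
    rcases B.eq_empty_or_nonempty with h0 | ⟨z0, hz0⟩
    · rw [h0]; simp
    have hg0 : (0 : ℤ) < g := by
      have := Nat.pos_of_mem_divisors hgd
      exact_mod_cast this
    have hgm : (g : ℤ) ^ 2 ∣ m := by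
      have h := mem_filter.1 hz0
      rw [← h.2]; exact hg _ h.1
    obtain ⟨m', hm'⟩ : g ^ 2 ∣ m := by exact_mod_cast hgm
    have hm'0 : 0 < m' := by
      rcases Nat.eq_zero_or_pos m' with h | h
      · rw [h] at hm'; omega
      · exact h
    have hdm : (m' : ℤ) ∣ (m : ℤ) := by rw [hm']; push_cast; exact dvd_mul_left _ _
    have hgx : ∀ z ∈ B, (g : ℤ) ∣ z.1 ∧ (g : ℤ) ∣ z.2 := by
      intro z hz
      rw [← (mem_filter.1 hz).2]
      exact ⟨Int.gcd_dvd_left .., Int.gcd_dvd_right ..⟩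
    have hinj : Set.InjOn (fun z : ℤ × ℤ => (z.1 / g, z.2 / g)) (B : Set (ℤ × ℤ)) := by
      rintro ⟨x, y⟩ h1 ⟨x2, y2⟩ h2 heq
      simp only [Prod.mk.injEq] at heq ⊢
      have e1 := Int.mul_ediv_cancel' (hgx _ h1).1
      have e2 := Int.mul_ediv_cancel' (hgx _ h2).1
      have e3 := Int.mul_ediv_cancel' (hgx _ h1).2
      have e4 := Int.mul_ediv_cancel' (hgx _ h2).2
      simp only at e1 e2 e3 e4
      refine ⟨by rw [← e1, ← e2, heq.1], by rw [← e3, ← e4, heq.2]⟩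
    rw [← card_image_of_injOn hinj]
    refine le_trans (prim_rep_bound (m := m') hα hβ (by exact_mod_cast hm'0)
      (hαm.of_isCoprime_of_dvd_right hdm) (hβm.of_isCoprime_of_dvd_right hdm) _ ?_) ?_
    · intro w hw
      obtain ⟨z, hz, rfl⟩ := mem_image.1 hw
      obtain ⟨⟨a, ha⟩, ⟨b, hb⟩⟩ := hgx z hz
      have hz' := mem_filter.1 hz
      have h := hA z hz'.1
      have hgg := hz'.2
      simp only
      rw [ha, hb] at hgg h
      rw [ha, hb, Int.mul_ediv_cancel_left _ hg0.ne', Int.mul_ediv_cancel_left _ hg0.ne']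
      constructor
      · rw [hm'] at h; push_cast at h
        apply mul_left_cancel₀ (pow_pos hg0 2).ne'
        linear_combination h
      · rw [Int.isCoprime_iff_gcd_eq_one]
        rw [Int.gcd_mul_left] at hgg
        simp only [Int.natAbs_natCast] at hgg
        have : 0 < g := by exact_mod_cast hg0
        exact Nat.eq_of_mul_eq_mul_left this (by omega)
    · simp only [Int.natAbs_natCast]
      have := card_divisors_mono (a := m') (b := m) (by exact_mod_cast hdm) hm.ne'
      exact Nat.mul_le_mul_left _ (Nat.pow_le_pow_left this _)


open Finset in
theorem log_card_divisors_le (m : ℕ) (hm : 0 < m) (z B : ℝ) (hz : 1 < z) (hB : 1 ≤ B)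
    (hmB : ∀ p : ℕ, (m.factorization p : ℝ) + 1 ≤ B) :
    Real.log (#m.divisors) ≤ z * Real.log B + (Real.log 2 / Real.log z) * Real.log m := by
  have hlz : 0 < Real.log z := Real.log_pos hz
  have hlB : 0 ≤ Real.log B := Real.log_nonneg hB
  have hl2 : 0 < Real.log 2 := Real.log_pos one_lt_two
  rw [Nat.card_divisors hm.ne']
  push_cast
  rw [Real.log_prod (fun p _ => by positivity)]
  have hlogm : Real.log m = ∑ p ∈ m.primeFactors, (m.factorization p : ℝ) * Real.log p := by
    conv_lhs => rw [← Nat.prod_factorization_pow_eq_self hm.ne']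
    rw [Finsupp.prod, Nat.cast_prod, Real.log_prod]
    · simp [Nat.support_factorization]
    · intro p hp
      have : p.Prime := Nat.prime_of_mem_primeFactors (by simpa using hp)
      have := this.pos
      positivity
  have hterm : ∀ p ∈ m.primeFactors, Real.log ((m.factorization p : ℝ) + 1) ≤
      (if (p : ℝ) ≤ z then Real.log B else 0) +
        (Real.log 2 / Real.log z) * ((m.factorization p : ℝ) * Real.log p) := by
    intro p hp
    have hpp : p.Prime := Nat.prime_of_mem_primeFactors hp
    have hlp : 0 < Real.log p := Real.log_pos (by exact_mod_cast hpp.one_lt)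
    split_ifs with h
    · have h1 : Real.log ((m.factorization p : ℝ) + 1) ≤ Real.log B :=
        Real.log_le_log (by positivity) (hmB p)
      have : 0 ≤ (Real.log 2 / Real.log z) * ((m.factorization p : ℝ) * Real.log p) := by positivity
      linarith
    · push Not at h
      have h1 : ((m.factorization p : ℝ) + 1) ≤ 2 ^ (m.factorization p) := by
        have : m.factorization p + 1 ≤ 2 ^ (m.factorization p) := Nat.lt_two_pow_self
        exact_mod_cast this
      have h2 := Real.log_le_log (by positivity) h1
      rw [Real.log_pow] at h2
      have h3 : Real.log z ≤ Real.log p := Real.log_le_log (by linarith) h.le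
      have h4 : Real.log 2 ≤ (Real.log 2 / Real.log z) * Real.log p := by
        rw [div_mul_eq_mul_div, le_div_iff₀ hlz]
        exact mul_le_mul_of_nonneg_left h3 hl2.le
      have h5 : (0:ℝ) ≤ m.factorization p := by positivity
      nlinarith
  refine (sum_le_sum hterm).trans ?_
  rw [sum_add_distrib, ← mul_sum, ← hlogm]
  gcongr
  rw [← sum_filter, sum_const, nsmul_eq_mul]
  gcongr
  have : (m.primeFactors.filter (fun p : ℕ => (p : ℝ) ≤ z)) ⊆ Icc 1 ⌊z⌋₊ := by
    intro p hp
    rw [mem_filter] at hp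
    rw [mem_Icc]
    exact ⟨(Nat.prime_of_mem_primeFactors hp.1).pos, Nat.le_floor hp.2⟩
  have h := card_le_card this
  rw [Nat.card_Icc, Nat.add_sub_cancel] at h
  calc (_ : ℝ) ≤ (⌊z⌋₊ : ℝ) := by exact_mod_cast h
    _ ≤ z := Nat.floor_le (by linarith)

open Filter Topology in
theorem asymp_aux : ∀ᶠ x : ℝ in atTop, Real.sqrt x * Real.log (15 * x) ≤ x / Real.log x := by
  have h1 : (fun x : ℝ => Real.log x ^ 2) =o[atTop] fun x : ℝ => x ^ (1/2 : ℝ) := by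
    have := isLittleO_log_rpow_rpow_atTop (s := 1/2) 2 (by norm_num)
    refine this.congr_left ?_
    intro x
    norm_num
  have h2 := h1.bound (c := 1/2) (by norm_num)
  filter_upwards [h2, eventually_ge_atTop 15] with x hx hx15
  have hx0 : (0:ℝ) < x := by linarith
  have hlx : 0 < Real.log x := Real.log_pos (by linarith)
  rw [← Real.sqrt_eq_rpow] at hx
  rw [Real.norm_of_nonneg (by positivity), Real.norm_of_nonneg (by positivity)] at hx
  rw [Real.log_mul (by norm_num) hx0.ne', le_div_iff₀ hlx]
  have h15 : Real.log 15 ≤ Real.log x := Real.log_le_log (by norm_num) hx15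
  have hs := Real.mul_self_sqrt hx0.le
  have hs0 := Real.sqrt_nonneg x
  have : (Real.log 15 + Real.log x) * Real.log x ≤ Real.sqrt x := by nlinarith
  calc _ = Real.sqrt x * ((Real.log 15 + Real.log x) * Real.log x) := by ring
    _ ≤ Real.sqrt x * Real.sqrt x := by gcongr
    _ = x := hs

open Filter Topology Finset in
theorem divisor_bound : ∀ᶠ n : ℕ in atTop, ∀ m : ℕ, 0 < m → m ≤ n ^ 9 →
    (#m.divisors : ℝ) ≤ Real.exp (14 * (Real.log n / Real.log (Real.log n))) := by
  have hT : Tendsto (fun n : ℕ => Real.log n) atTop atTop :=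
    Real.tendsto_log_atTop.comp tendsto_natCast_atTop_atTop
  filter_upwards [hT.eventually asymp_aux, hT.eventually (eventually_ge_atTop 2)] with n h1 h2 m hm hmn
  set x := Real.log n with hx
  have hx0 : 0 < x := by linarith
  have hlx : 0 < Real.log x := Real.log_pos (by linarith)
  have hd : 0 < #m.divisors := Finset.card_pos.2 ⟨1, by simp [hm.ne']⟩
  have hd' : (0 : ℝ) < #m.divisors := by exact_mod_cast hd
  rw [← Real.log_le_iff_le_exp hd']
  have hn0 : 0 < n := by
    rcases Nat.eq_zero_or_pos n with h | h
    · simp [h, x] at hx0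
    · exact h
  have hlm : Real.log m ≤ 9 * x := by
    have : Real.log m ≤ Real.log ((n:ℝ) ^ 9) :=
      Real.log_le_log (by exact_mod_cast hm) (by exact_mod_cast hmn)
    rw [Real.log_pow] at this
    simpa using this
  have hl2 : 0.6931471803 < Real.log 2 := Real.log_two_gt_d9
  have hl2' : Real.log 2 < 0.6931471808 := Real.log_two_lt_d9
  have key := log_card_divisors_le m hm (Real.sqrt x) (15 * x)
    (by rw [Real.lt_sqrt (by norm_num)]; linarith) (by linarith) (by
      intro p
      have h3 : 2 ^ m.factorization p ≤ m := by
        by_cases hp : p.Prime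
        · exact (Nat.pow_le_pow_left hp.two_le _).trans (Nat.ordProj_le p hm.ne')
        · rw [Nat.factorization_eq_zero_of_not_prime _ hp]; simpa using Nat.succ_le_of_lt hm
      have h4 : ((2:ℝ) ^ m.factorization p) ≤ m := by exact_mod_cast h3
      have h5 := Real.log_le_log (by positivity) h4
      rw [Real.log_pow] at h5
      have h6 : (0:ℝ) ≤ m.factorization p := by positivity
      nlinarith)
  have hsq : Real.log (Real.sqrt x) = Real.log x / 2 := Real.log_sqrt hx0.le
  rw [hsq] at key
  have : Real.log 2 / (Real.log x / 2) * Real.log m ≤ 13 * (x / Real.log x) := by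
    calc _ ≤ Real.log 2 / (Real.log x / 2) * (9 * x) := by gcongr
      _ = (18 * Real.log 2) * (x / Real.log x) := by field_simp; ring
      _ ≤ _ := by gcongr; linarith
  linarith


section Core
open Finset Module
open scoped Classical

/-- A functional `ℓ` encodes a sphere; these are the points of `G` on it. -/
noncomputable def Sph {α V : Type*} [AddCommGroup V] [Module ℝ V] (φ : α → V) (Q : α → ℝ)
    (G : Finset α) (l : V →ₗ[ℝ] ℝ) : Finset α := G.filter (fun p => Q p = l (φ p))

variable {α V : Type*} [AddCommGroup V] [Module ℝ V]

theorem mem_Sph {φ : α → V} {Q : α → ℝ} {G : Finset α} {l : V →ₗ[ℝ] ℝ} {p : α} :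
    p ∈ Sph φ Q G l ↔ p ∈ G ∧ Q p = l (φ p) := by simp [Sph]

theorem good_tuples (φ : α → V) (A : Finset α) (M : ℕ) : ∀ (t : ℕ),
    (∀ k < t, ∀ u : Fin k → α, LinearIndependent ℝ (φ ∘ u) → (∀ i, u i ∈ A) →
      #(A.filter (fun p => φ p ∈ Submodule.span ℝ (Set.range (φ ∘ u)))) ≤ M) →
    (#A - M) ^ t ≤ #((Fintype.piFinset (fun _ : Fin t => A)).filter
      (fun u => LinearIndependent ℝ (φ ∘ u))) := by
  intro t
  induction t with
  | zero =>
    intro _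
    rw [pow_zero, Nat.one_le_iff_ne_zero, Finset.card_ne_zero]
    refine ⟨Fin.elim0, ?_⟩
    simp [linearIndependent_empty_type]
    exact Subsingleton.elim _ _
  | succ t ih =>
    intro h
    have ih' := ih (fun k hk => h k (by omega))
    set T := (Fintype.piFinset (fun _ : Fin t => A)).filter
      (fun u => LinearIndependent ℝ (φ ∘ u)) with hT
    set T' := (Fintype.piFinset (fun _ : Fin (t+1) => A)).filter
      (fun u => LinearIndependent ℝ (φ ∘ u)) with hT'
    have h1 : #(T.sigma (fun u => A.filter (fun p => ¬ φ p ∈ Submodule.span ℝ (Set.range (φ ∘ u))))) ≤ #T' := by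
      refine card_le_card_of_injOn (fun z => (Fin.cons z.2 z.1 : Fin (t+1) → α)) ?_ ?_
      · rintro ⟨u, p⟩ hz
        simp only [coe_sigma, Set.mem_sigma_iff, mem_coe, mem_filter, hT, Fintype.mem_piFinset] at hz
        simp only [hT', mem_coe, mem_filter, Fintype.mem_piFinset]
        refine ⟨?_, ?_⟩
        · intro i
          refine Fin.cases ?_ ?_ i
          · simpa using hz.2.1
          · intro j; simpa using hz.1.1 j
        · have : φ ∘ (Fin.cons p u : Fin (t+1) → α) = Fin.cons (φ p) (φ ∘ u) := by
            funext i
            refine Fin.cases ?_ ?_ i <;> simp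
          rw [this, linearIndependent_finCons]
          exact ⟨hz.1.2, hz.2.2⟩
      · rintro ⟨u, p⟩ _ ⟨u', p'⟩ _ heq
        simp only at heq
        have := Fin.cons_injective2 heq
        obtain ⟨rfl, rfl⟩ := this
        rfl
    refine le_trans ?_ h1
    rw [card_sigma, pow_succ]
    calc (#A - M) ^ t * (#A - M) ≤ #T * (#A - M) := Nat.mul_le_mul_right _ ih'
      _ = ∑ _u ∈ T, (#A - M) := by rw [sum_const, smul_eq_mul]
      _ ≤ _ := by
        refine sum_le_sum ?_
        intro u hu
        rw [hT, mem_filter, Fintype.mem_piFinset] at hu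
        have h2 := h t (by omega) u hu.2 hu.1
        have h3 := card_filter_add_card_filter_not (s := A)
          (fun p => φ p ∈ Submodule.span ℝ (Set.range (φ ∘ u)))
        omega

theorem exchange_aux [FiniteDimensional ℝ V] {D t : ℕ} (hD : finrank ℝ V = D) (v : Fin t → V)
    (hv : LinearIndependent ℝ v) (b : Fin D → V) (hb : Submodule.span ℝ (Set.range b) = ⊤) :
    ∀ m : ℕ, t + m ≤ D → ∃ e : Fin m → Fin D, LinearIndependent ℝ (Fin.append v (b ∘ e)) := by
  intro m
  induction m with
  | zero =>
    intro _
    refine ⟨Fin.elim0, ?_⟩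
    have : b ∘ Fin.elim0 = Fin.elim0 := by funext i; exact i.elim0
    rw [this, Fin.append_elim0]
    exact (linearIndependent_equiv' (finCongr (by simp)) (by rfl)).2 hv
  | succ m ih =>
    intro hm
    obtain ⟨e, he⟩ := ih (by omega)
    have : ∃ i, b i ∉ Submodule.span ℝ (Set.range (Fin.append v (b ∘ e))) := by
      by_contra hcon
      push Not at hcon
      have h1 : Submodule.span ℝ (Set.range b) ≤ Submodule.span ℝ (Set.range (Fin.append v (b ∘ e))) := by
        rw [Submodule.span_le]
        rintro _ ⟨i, rfl⟩
        exact hcon i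
      rw [hb, top_le_iff] at h1
      have h2 := finrank_range_le_card (R := ℝ) (Fin.append v (b ∘ e))
      rw [Set.finrank, h1, finrank_top, hD, Fintype.card_fin] at h2
      omega
    obtain ⟨i, hi⟩ := this
    refine ⟨Fin.snoc e i, ?_⟩
    have h3 : b ∘ (Fin.snoc e i : Fin (m+1) → Fin D) = Fin.snoc (b ∘ e) (b i) := by
      rw [Fin.comp_snoc]
    rw [h3, Fin.append_snoc]
    exact linearIndependent_finSnoc.2 ⟨he, hi⟩

theorem exchange [FiniteDimensional ℝ V] {D t m : ℕ} (hD : finrank ℝ V = D) (htm : D = t + m)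
    (v : Fin t → V) (hv : LinearIndependent ℝ v) (b : Fin D → V) (hb : LinearIndependent ℝ b) :
    ∃ σ : Fin m ⊕ Fin t ≃ Fin D,
      Submodule.span ℝ (Set.range v ∪ Set.range (b ∘ σ ∘ Sum.inl)) = ⊤ := by
  have hbs : Submodule.span ℝ (Set.range b) = ⊤ :=
    hb.span_eq_top_of_card_eq_finrank' (by simp [hD])
  obtain ⟨e, he⟩ := exchange_aux hD v hv b hbs m htm.ge
  have hinj : Function.Injective e := by
    intro i j hij
    have h1 : Fin.append v (b ∘ e) (Fin.natAdd t i) = Fin.append v (b ∘ e) (Fin.natAdd t j) := by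
      simp [hij]
    have := he.injective h1
    simpa using this
  have hc : Fintype.card {x // x ∉ Set.range e} = t := by
    rw [Fintype.card_subtype_compl]
    have : Fintype.card {x // x ∈ Set.range e} = m := by
      rw [← Fintype.card_congr (Equiv.ofInjective e hinj), Fintype.card_fin]
    rw [this, Fintype.card_fin]; omega
  let τ : Fin t ≃ {x // x ∉ Set.range e} := (Fintype.equivFinOfCardEq hc).symm
  let σ : Fin m ⊕ Fin t ≃ Fin D :=
    (Equiv.sumCongr (Equiv.ofInjective e hinj) τ).trans (Equiv.Set.sumCompl (Set.range e))
  have hσ : σ ∘ Sum.inl = e := by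
    funext i
    simp [σ]
    rfl
  refine ⟨σ, ?_⟩
  rw [hσ]
  have h4 := he.span_eq_top_of_card_eq_finrank' (by simp [hD, htm])
  rw [eq_top_iff, ← h4]
  apply Submodule.span_mono
  rintro _ ⟨i, rfl⟩
  refine Fin.addCases ?_ ?_ i
  · intro j; left; simp
  · intro j; right; simp

theorem core_bound {κT β : Type*} [FiniteDimensional ℝ V] (φ : α → V) (Q : α → ℝ) (G : Finset α)
    {D t' m : ℕ} (hD : finrank ℝ V = D) (hDm : D = (t' + 1) + m) (M N Lc r : ℕ)
    (hM : ∀ l : V →ₗ[ℝ] ℝ, ∀ k < t' + 1, ∀ u : Fin k → α, LinearIndependent ℝ (φ ∘ u) →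
      (∀ i, u i ∈ Sph φ Q G l) →
      #((Sph φ Q G l).filter (fun p => φ p ∈ Submodule.span ℝ (Set.range (φ ∘ u)))) ≤ M)
    (κ : α → κT)
    (hcell : #((Fintype.piFinset (fun _ : Fin (t' + 1) => G)).filter
      (fun u => ∀ i, κ (u i) = κ (u 0))) ≤ Lc)
    (hΦ : ∀ l : V →ₗ[ℝ] ℝ, ∃ Φ : α → β,
      (∀ x ∈ Sph φ Q G l, ∀ y ∈ Sph φ Q G l, Φ x = Φ y → κ x = κ y) ∧
      #((Sph φ Q G l).image Φ) ≤ N)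
    (ell : (Fin D → α) → (V →ₗ[ℝ] ℝ))
    (hell : ∀ q : Fin D → α, LinearIndependent ℝ (φ ∘ q) → ∀ i, Q (q i) = ell q (φ (q i)))
    (hr : 2 * N * M ≤ r) (hr0 : 0 < r) :
    #((Fintype.piFinset (fun _ : Fin D => G)).filter (fun q => LinearIndependent ℝ (φ ∘ q) ∧
      r ≤ #(Sph φ Q G (ell q)) ∧ #(Sph φ Q G (ell q)) < 2 * r)) ≤
    4 ^ (t' + 1) * N ^ t' * (Fintype.card (Fin m ⊕ Fin (t' + 1) ≃ Fin D)) * Lc * #G ^ m := by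
  set E := (Fintype.piFinset (fun _ : Fin D => G)).filter (fun q => LinearIndependent ℝ (φ ∘ q) ∧
      r ≤ #(Sph φ Q G (ell q)) ∧ #(Sph φ Q G (ell q)) < 2 * r) with hE
  set Cells := (Fintype.piFinset (fun _ : Fin (t' + 1) => G)).filter
      (fun u => ∀ i, κ (u i) = κ (u 0)) with hCells
  let Good : (Fin D → α) → Finset (Fin (t' + 1) → α) := fun q =>
    (Fintype.piFinset (fun _ : Fin (t' + 1) => Sph φ Q G (ell q))).filter
      (fun u => LinearIndependent ℝ (φ ∘ u) ∧ ∀ i, κ (u i) = κ (u 0))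
  -- lower bound for the number of good tuples
  have lower : ∀ q ∈ E, r ^ (t' + 1) ≤ 2 ^ (t' + 1) * N ^ t' * #(Good q) := by
    intro q hq
    rw [hE, mem_filter] at hq
    obtain ⟨-, hqi, hqr, -⟩ := hq
    set S := Sph φ Q G (ell q) with hS
    obtain ⟨Φ, hΦ1, hΦ2⟩ := hΦ (ell q)
    rw [← hS] at hΦ1 hΦ2
    set I := S.image Φ with hI
    have hsum : ∑ b ∈ I, #(S.filter (fun x => Φ x = b)) = #S :=
      (card_eq_sum_card_image Φ S).symm
    have hsub : #S ≤ ∑ b ∈ I, (#(S.filter (fun x => Φ x = b)) - M) + N * M := by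
      rw [← hsum]
      calc _ ≤ ∑ b ∈ I, ((#(S.filter (fun x => Φ x = b)) - M) + M) := by
            apply sum_le_sum; intro b _; omega
        _ = ∑ b ∈ I, (#(S.filter (fun x => Φ x = b)) - M) + #I * M := by
            rw [sum_add_distrib, sum_const, smul_eq_mul]
        _ ≤ _ := by gcongr
    have hhalf : r ≤ 2 * ∑ b ∈ I, (#(S.filter (fun x => Φ x = b)) - M) := by
      nlinarith
    have hpm : (∑ b ∈ I, (#(S.filter (fun x => Φ x = b)) - M)) ^ (t' + 1) ≤
        N ^ t' * ∑ b ∈ I, (#(S.filter (fun x => Φ x = b)) - M) ^ (t' + 1) := by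
      rcases I.eq_empty_or_nonempty with h0 | hne
      · rw [h0]; simp
      have h := pow_sum_div_card_le_sum_pow (s := I)
        (f := fun b => ((#(S.filter (fun x => Φ x = b)) - M : ℕ) : ℝ)) (fun _ _ => by positivity) t'
      have hIp : (0:ℝ) < (#I : ℝ) ^ t' := by
        have := card_pos.2 hne
        positivity
      rw [div_le_iff₀ hIp] at h
      have h' : (∑ b ∈ I, (#(S.filter (fun x => Φ x = b)) - M)) ^ (t' + 1) ≤
        (∑ b ∈ I, (#(S.filter (fun x => Φ x = b)) - M) ^ (t' + 1)) * #I ^ t' := by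
        exact_mod_cast h
      refine h'.trans ?_
      rw [mul_comm]
      gcongr
    have hgood : ∑ b ∈ I, (#(S.filter (fun x => Φ x = b)) - M) ^ (t' + 1) ≤ #(Good q) := by
      have hb : ∀ b ∈ I, (#(S.filter (fun x => Φ x = b)) - M) ^ (t' + 1) ≤
          #((Good q).filter (fun u => Φ (u 0) = b)) := by
        intro b _
        refine (good_tuples φ (S.filter (fun x => Φ x = b)) M (t' + 1) ?_).trans ?_
        · intro k hk u hu huA
          refine le_trans (card_le_card ?_) (hM (ell q) k hk u hu (fun i => (mem_filter.1 (huA i)).1))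
          rw [← hS]
          exact filter_subset_filter _ (filter_subset _ _)
        · apply card_le_card
          intro u hu
          simp only [mem_filter, Fintype.mem_piFinset, Good] at hu ⊢
          rw [← hS]
          refine ⟨⟨fun i => (hu.1 i).1, hu.2, ?_⟩, (hu.1 0).2⟩
          intro i
          exact hΦ1 _ (hu.1 i).1 _ (hu.1 0).1 ((hu.1 i).2.trans (hu.1 0).2.symm)
      refine (sum_le_sum hb).trans ?_
      refine (card_eq_sum_card_fiberwise (s := Good q) (t := I) (f := fun u => Φ (u 0)) ?_).ge
      intro u hu
      have hu' := (mem_filter.1 (mem_coe.1 hu)).1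
      rw [Fintype.mem_piFinset] at hu'
      exact mem_image_of_mem _ (hu' 0)
    calc r ^ (t' + 1) ≤ (2 * ∑ b ∈ I, (#(S.filter (fun x => Φ x = b)) - M)) ^ (t' + 1) := by gcongr
      _ = 2 ^ (t' + 1) * (∑ b ∈ I, (#(S.filter (fun x => Φ x = b)) - M)) ^ (t' + 1) := by rw [mul_pow]
      _ ≤ 2 ^ (t' + 1) * (N ^ t' * #(Good q)) := by
        gcongr
        exact hpm.trans (Nat.mul_le_mul_left _ hgood)
      _ = _ := by ring
  -- upper bound for the number of pairs
  have upper : ∑ q ∈ E, #(Good q) ≤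
      (Fintype.card (Fin m ⊕ Fin (t' + 1) ≃ Fin D)) * ((2 * r) ^ (t' + 1) * (#G ^ m * Lc)) := by
    rw [← card_sigma]
    let X : (Fin m ⊕ Fin (t' + 1) ≃ Fin D) → Finset ((_ : Fin D → α) × (Fin (t' + 1) → α)) := fun σ =>
      (E.sigma Good).filter (fun z =>
        Submodule.span ℝ (Set.range (φ ∘ z.2) ∪ Set.range ((φ ∘ z.1) ∘ σ ∘ Sum.inl)) = ⊤)
    have hcov : E.sigma Good ⊆ univ.biUnion X := by
      rintro ⟨q, u⟩ hz
      rw [mem_biUnion]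
      have hz' := mem_sigma.1 hz
      have hq := (mem_filter.1 hz'.1).2.1
      have hu := (mem_filter.1 hz'.2).2.1
      obtain ⟨σ, hσ⟩ := exchange hD hDm (φ ∘ u) hu (φ ∘ q) hq
      exact ⟨σ, mem_univ _, mem_filter.2 ⟨hz, hσ⟩⟩
    refine (card_le_card hcov).trans (card_biUnion_le.trans ?_)
    have hX : ∀ σ ∈ (univ : Finset (Fin m ⊕ Fin (t' + 1) ≃ Fin D)),
        #(X σ) ≤ (2 * r) ^ (t' + 1) * (#G ^ m * Lc) := by
      intro σ _
      have hT : #((Fintype.piFinset (fun _ : Fin m => G)) ×ˢ Cells) ≤ #G ^ m * Lc := by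
        rw [card_product, Fintype.card_piFinset_const]
        gcongr
      refine le_trans ?_ (Nat.mul_le_mul_left _ hT)
      refine card_le_mul_card_image_of_maps_to (f := fun z => (z.1 ∘ σ ∘ Sum.inl, z.2)) ?_ _ ?_
      · rintro ⟨q, u⟩ hz
        have hz1 := mem_sigma.1 (mem_filter.1 hz).1
        have hq := (mem_filter.1 hz1.1).1
        have hu := mem_filter.1 hz1.2
        rw [Fintype.mem_piFinset] at hq
        have hu1 := hu.1
        rw [Fintype.mem_piFinset] at hu1
        simp only [mem_product, Fintype.mem_piFinset, hCells, mem_filter]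
        exact ⟨fun i => hq _, fun i => (mem_Sph.1 (hu1 i)).1, hu.2.2⟩
      · rintro ⟨v, u⟩ -
        set F := (X σ).filter (fun z => (z.1 ∘ σ ∘ Sum.inl, z.2) = (v, u)) with hF
        rcases F.eq_empty_or_nonempty with h0 | ⟨⟨q0, u0⟩, hz0⟩
        · rw [h0]; simp
        have facts : ∀ z ∈ F, z.1 ∘ σ ∘ Sum.inl = v ∧ z.2 = u ∧ z.1 ∈ E ∧
            (∀ w ∈ Set.range (φ ∘ u) ∪ Set.range (φ ∘ v), ∃ p, w = φ p ∧ Q p = ell z.1 (φ p)) ∧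
            Submodule.span ℝ (Set.range (φ ∘ u) ∪ Set.range (φ ∘ v)) = ⊤ ∧
            (∀ i, z.1 i ∈ Sph φ Q G (ell z.1)) := by
          rintro ⟨q, u'⟩ hz
          rw [hF, mem_filter] at hz
          obtain ⟨hzX, heq⟩ := hz
          simp only [Prod.mk.injEq] at heq
          obtain ⟨rfl, rfl⟩ := heq
          obtain ⟨hzs, hsp⟩ := mem_filter.1 hzX
          obtain ⟨hqE, hug⟩ := mem_sigma.1 hzs
          have hqE' := mem_filter.1 hqE
          have hug' := mem_filter.1 hug
          have hu1 := hug'.1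
          rw [Fintype.mem_piFinset] at hu1
          have hq1 := hqE'.1
          rw [Fintype.mem_piFinset] at hq1
          refine ⟨rfl, rfl, hqE, ?_, hsp, ?_⟩
          · rintro w (⟨i, rfl⟩ | ⟨i, rfl⟩)
            · exact ⟨u' i, rfl, (mem_Sph.1 (hu1 i)).2⟩
            · exact ⟨q (σ (Sum.inl i)), rfl, hell q hqE'.2.1 _⟩
          · intro i
            exact mem_Sph.2 ⟨hq1 i, hell q hqE'.2.1 _⟩
        obtain ⟨f1, f2, f3, f4, f5, f6⟩ := facts _ hz0
        have same : ∀ z ∈ F, ell z.1 = ell q0 := by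
          intro z hz
          obtain ⟨g1, g2, g3, g4, g5, g6⟩ := facts z hz
          have : Set.EqOn (ell z.1) (ell q0) (Set.range (φ ∘ u) ∪ Set.range (φ ∘ v)) := by
            rintro w (⟨i, rfl⟩ | ⟨i, rfl⟩)
            · have hz1 := mem_sigma.1 (mem_filter.1 (mem_filter.1 hz).1).1
              have hz2 := mem_sigma.1 (mem_filter.1 (mem_filter.1 hz0).1).1
              have h1 := (mem_filter.1 hz1.2).1
              have h2 := (mem_filter.1 hz2.2).1
              rw [Fintype.mem_piFinset] at h1 h2
              have e1 := (mem_Sph.1 (h1 i)).2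
              have e2 := (mem_Sph.1 (h2 i)).2
              rw [g2] at e1
              rw [f2] at e2
              exact e1.symm.trans e2
            · have e1 := (mem_Sph.1 (g6 (σ (Sum.inl i)))).2
              have e2 : Q (q0 (σ (Sum.inl i))) = ell q0 (φ (q0 (σ (Sum.inl i)))) :=
                (mem_Sph.1 (f6 (σ (Sum.inl i)))).2
              have e3 := congrFun g1 i
              have e4 := congrFun f1 i
              simp only [Function.comp_apply] at e3 e4
              rw [e3] at e1
              rw [e4] at e2
              exact e1.symm.trans e2
          exact LinearMap.ext_on g5 this
        have hcard : #F ≤ #(Fintype.piFinset (fun _ : Fin (t' + 1) => Sph φ Q G (ell q0))) := by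
          refine card_le_card_of_injOn (fun z => z.1 ∘ σ ∘ Sum.inr) ?_ ?_
          · intro z hz
            rw [mem_coe, Fintype.mem_piFinset]
            intro i
            rw [← same z hz]
            exact (facts z hz).2.2.2.2.2 _
          · rintro ⟨q, u1⟩ hz ⟨q', u2⟩ hz' heq
            obtain ⟨g1, g2, -⟩ := facts _ hz
            obtain ⟨g1', g2', -⟩ := facts _ hz'
            simp only at g1 g2 g1' g2' heq
            have hqq : q = q' := by
              funext i
              obtain ⟨j, rfl⟩ := σ.surjective i
              rcases j with j | j
              · have := congrFun (g1.trans g1'.symm) j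
                simpa using this
              · have := congrFun heq j
                simpa using this
            subst hqq
            rw [g2, g2']
        refine hcard.trans ?_
        rw [Fintype.card_piFinset_const]
        exact Nat.pow_le_pow_left (mem_filter.1 f3).2.2.2.le _
    refine (sum_le_sum hX).trans ?_
    rw [sum_const, smul_eq_mul, card_univ]
  have hfin : #E * r ^ (t' + 1) ≤ (4 ^ (t' + 1) * N ^ t' *
      (Fintype.card (Fin m ⊕ Fin (t' + 1) ≃ Fin D)) * Lc * #G ^ m) * r ^ (t' + 1) := by
    calc #E * r ^ (t' + 1) = ∑ _q ∈ E, r ^ (t' + 1) := by rw [sum_const, smul_eq_mul]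
      _ ≤ ∑ q ∈ E, 2 ^ (t' + 1) * N ^ t' * #(Good q) := sum_le_sum lower
      _ = 2 ^ (t' + 1) * N ^ t' * ∑ q ∈ E, #(Good q) := by rw [mul_sum]
      _ ≤ 2 ^ (t' + 1) * N ^ t' * ((Fintype.card (Fin m ⊕ Fin (t' + 1) ≃ Fin D)) *
          ((2 * r) ^ (t' + 1) * (#G ^ m * Lc))) := by gcongr
      _ = _ := by
        rw [show (4:ℕ) = 2 * 2 by norm_num, mul_pow, mul_pow]; ring
  exact Nat.le_of_mul_le_mul_right hfin (pow_pos hr0 _)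

end Core


section Geometry
open Finset Module
open scoped Classical

abbrev VV (d : ℕ) : Type := ℝ × (Fin d → ℝ)

noncomputable def phi {d : ℕ} (p : Fin d → ℤ) : VV d := (1, fun i => (p i : ℝ))

noncomputable def Qf {d : ℕ} (p : Fin d → ℤ) : ℝ := ∑ i, (p i : ℝ) ^ 2

noncomputable def Gr (d n : ℕ) : Finset (Fin d → ℤ) := Fintype.piFinset (fun _ => Finset.Icc 1 (n : ℤ))

theorem mem_Gr {d n : ℕ} {p : Fin d → ℤ} : p ∈ Gr d n ↔ ∀ i, 1 ≤ p i ∧ p i ≤ n := by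
  simp [Gr, Fintype.mem_piFinset]

theorem card_Gr (d n : ℕ) : #(Gr d n) = n ^ d := by
  simp [Gr]

theorem finrank_VV (d : ℕ) : finrank ℝ (VV d) = d + 1 := by
  simp [VV, Module.finrank_prod]; ring

theorem phi_inj {d : ℕ} {p q : Fin d → ℤ} (h : phi p = phi q) : p = q := by
  simp only [phi, Prod.mk.injEq, true_and] at h
  funext i
  exact_mod_cast congrFun h i

/-- centre of the sphere encoded by a functional -/
noncomputable def cen {d : ℕ} (l : VV d →ₗ[ℝ] ℝ) (i : Fin d) : ℝ := l (0, Pi.single i 1) / 2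

theorem sphere_eq {d : ℕ} (l : VV d →ₗ[ℝ] ℝ) (p : Fin d → ℤ) (h : Qf p = l (phi p)) :
    ∑ i, ((p i : ℝ) - cen l i) ^ 2 = l (1, 0) + ∑ i, cen l i ^ 2 := by
  have h1 : phi p = (1, 0) + ∑ i, (p i : ℝ) • ((0, Pi.single i 1) : VV d) := by
    refine Prod.ext ?_ ?_
    · simp [phi, Prod.fst_sum]
    · funext j
      simp [phi, Prod.snd_sum, Finset.sum_apply, Pi.single_apply]
  rw [h1, map_add, map_sum] at h
  simp only [map_smul, smul_eq_mul] at h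
  have h2 : ∑ i, ((p i : ℝ) - cen l i) ^ 2 =
      Qf p - ∑ i, (p i : ℝ) * l (0, Pi.single i 1) + ∑ i, cen l i ^ 2 := by
    rw [Qf, ← sum_sub_distrib, ← sum_add_distrib]
    refine sum_congr rfl ?_
    intro i _
    have : l (0, Pi.single i 1) = 2 * cen l i := by simp [cen]; ring
    rw [this]; ring
  rw [h2, h]; ring

theorem collinear_lemma {d : ℕ} (l : VV d →ₗ[ℝ] ℝ) (x y z : Fin d → ℤ)
    (hx : Qf x = l (phi x)) (hy : Qf y = l (phi y)) (hz : Qf z = l (phi z)) (b : ℝ)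
    (hb : ∀ k, (z k : ℝ) - x k = b * ((y k : ℝ) - x k)) : x = y ∨ z = x ∨ z = y := by
  have h1 : phi z = (1 - b) • phi x + b • phi y := by
    refine Prod.ext ?_ ?_
    · simp [phi]
    · funext k
      simp [phi]
      linear_combination hb k
  have h2 : Qf z = (1 - b) * Qf x + b * Qf y := by
    rw [hz, h1, map_add, map_smul, map_smul, smul_eq_mul, smul_eq_mul, hx, hy]
  have h3 : (1 - b) * b * ∑ k, ((x k : ℝ) - y k) ^ 2 = (1 - b) * Qf x + b * Qf y - Qf z := by
    simp only [Qf, mul_sum]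
    rw [← sum_add_distrib, ← sum_sub_distrib]
    refine sum_congr rfl ?_
    intro k _
    have : (z k : ℝ) = x k + b * ((y k : ℝ) - x k) := by linear_combination hb k
    rw [this]; ring
  rw [h2, sub_self, mul_eq_zero, mul_eq_zero] at h3
  rcases h3 with (h | h) | h
  · right; right
    have : b = 1 := by linarith
    subst this
    apply phi_inj
    rw [h1]; simp
  · right; left
    subst h
    apply phi_inj
    rw [h1]; simp
  · left
    rw [sum_eq_zero_iff_of_nonneg (fun _ _ => sq_nonneg _)] at h
    funext k
    have := h k (mem_univ _)
    have h5 : (x k : ℝ) - y k = 0 := by simpa using this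
    have : (x k : ℝ) = y k := by linarith
    exact_mod_cast this

theorem collinear_card {d : ℕ} (l : VV d →ₗ[ℝ] ℝ) (F : Finset (Fin d → ℤ))
    (hF : ∀ x ∈ F, Qf x = l (phi x))
    (h : ∀ x ∈ F, ∀ y ∈ F, ∀ z ∈ F, x ≠ y → ∃ b : ℝ, ∀ k, (z k : ℝ) - x k = b * ((y k : ℝ) - x k)) :
    #F ≤ 2 := by
  by_contra hc
  push Not at hc
  rw [Finset.two_lt_card] at hc
  obtain ⟨x, hx, y, hy, z, hz, hxy, hxz, hyz⟩ := hc
  obtain ⟨b, hb⟩ := h x hx y hy z hz hxy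
  rcases collinear_lemma l x y z (hF x hx) (hF y hy) (hF z hz) b hb with h | h | h
  · exact hxy h
  · exact hxz h.symm
  · exact hyz h.symm

theorem card_fiber {d n : ℕ} (S : Finset (Fin d)) (A : Finset (Fin d → ℤ)) (hA : A ⊆ Gr d n) (M : ℕ)
    (h : ∀ x ∈ A, #(A.filter (fun y => ∀ k, k ∉ S → y k = x k)) ≤ M) :
    #A ≤ M * n ^ (d - #S) := by
  have hT : #(Fintype.piFinset (fun _ : {k // k ∉ S} => Finset.Icc 1 (n : ℤ))) = n ^ (d - #S) := by
    simp [Fintype.card_piFinset, Fintype.card_subtype_compl]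
  rw [← hT]
  refine card_le_mul_card_image_of_maps_to (f := fun p (k : {k // k ∉ S}) => p k) ?_ _ ?_
  · intro p hp
    rw [Fintype.mem_piFinset]
    intro k
    rw [Finset.mem_Icc]
    exact mem_Gr.1 (hA hp) k
  · intro b _
    rcases (A.filter (fun p => (fun (k : {k // k ∉ S}) => p k) = b)).eq_empty_or_nonempty with h0 | ⟨x, hx⟩
    · rw [h0]; simp
    rw [mem_filter] at hx
    refine le_trans (card_le_card ?_) (h x hx.1)
    intro y hy
    rw [mem_filter] at hy ⊢
    refine ⟨hy.1, ?_⟩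
    intro k hk
    exact congrFun (hy.2.trans hx.2.symm) ⟨k, hk⟩

theorem sph_card {d n : ℕ} (hd : 0 < d) (l : VV d →ₗ[ℝ] ℝ) :
    #(Sph phi Qf (Gr d n) l) ≤ 2 * n ^ (d - 1) := by
  let i : Fin d := ⟨0, hd⟩
  have := card_fiber (n := n) {i} (Sph phi Qf (Gr d n) l) (filter_subset _ _) 2 ?_
  · simpa using this
  intro x hx
  apply collinear_card l
  · intro y hy
    exact (mem_Sph.1 (mem_filter.1 hy).1).2
  · intro u hu v hv w hw huv
    rw [mem_filter] at hu hv hw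
    have hi : (v i : ℝ) - u i ≠ 0 := by
      intro h
      apply huv
      funext k
      by_cases hk : k = i
      · subst hk
        have : (v i : ℝ) = u i := by linarith
        exact_mod_cast this.symm
      · rw [hu.2 k (by simpa using hk), hv.2 k (by simpa using hk)]
    refine ⟨((w i : ℝ) - u i) / ((v i : ℝ) - u i), ?_⟩
    intro k
    by_cases hk : k = i
    · subst hk; field_simp
    · rw [hu.2 k (by simpa using hk), hv.2 k (by simpa using hk), hw.2 k (by simpa using hk)]; simp

theorem hyper_card {d n : ℕ} (hd : 2 ≤ d) (l : VV d →ₗ[ℝ] ℝ) (W : Submodule ℝ (VV d)) (hW : W ≠ ⊤) :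
    #((Sph phi Qf (Gr d n) l).filter (fun p => phi p ∈ W)) ≤ 2 * n ^ (d - 2) := by
  obtain ⟨f, hf0, hf⟩ := Submodule.exists_le_ker_of_lt_top W (lt_top_iff_ne_top.2 hW)
  have hphi : ∀ p : Fin d → ℤ, f (phi p) = f (1, 0) + ∑ i, (p i : ℝ) * f (0, Pi.single i 1) := by
    intro p
    have h1 : phi p = (1, 0) + ∑ i, (p i : ℝ) • ((0, Pi.single i 1) : VV d) := by
      refine Prod.ext ?_ ?_
      · simp [phi, Prod.fst_sum]
      · funext j
        simp [phi, Prod.snd_sum, Finset.sum_apply, Pi.single_apply]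
    rw [h1, map_add, map_sum]
    simp only [map_smul, smul_eq_mul]
  by_cases hall : ∀ i, f (0, Pi.single i 1) = 0
  · have h10 : f (1, 0) ≠ 0 := by
      intro h0
      apply hf0
      apply LinearMap.ext
      intro v
      have h1 : v = v.1 • ((1, 0) : VV d) + ∑ i, (v.2 i : ℝ) • ((0, Pi.single i 1) : VV d) := by
        refine Prod.ext ?_ ?_
        · simp [Prod.fst_sum]
        · funext j
          simp [Prod.snd_sum, Finset.sum_apply, Pi.single_apply]
      rw [h1, map_add, map_sum]
      simp only [map_smul, smul_eq_mul, h0, hall]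
      simp
    have : (Sph phi Qf (Gr d n) l).filter (fun p => phi p ∈ W) = ∅ := by
      rw [filter_eq_empty_iff]
      intro p _ hp
      have h1 : f (phi p) = 0 := hf hp
      rw [hphi] at h1
      simp [hall] at h1
      exact h10 h1
    rw [this]; simp
  push Not at hall
  obtain ⟨i, hi⟩ := hall
  obtain ⟨j, hji⟩ : ∃ j : Fin d, j ≠ i := by
    have : Nontrivial (Fin d) := Fin.nontrivial_iff_two_le.2 hd
    exact exists_ne i
  have := card_fiber (n := n) {i, j} ((Sph phi Qf (Gr d n) l).filter (fun p => phi p ∈ W))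
    ((filter_subset _ _).trans (filter_subset _ _)) 2 ?_
  · rwa [card_pair hji.symm] at this
  intro x hx
  have key : ∀ u ∈ (((Sph phi Qf (Gr d n) l).filter (fun p => phi p ∈ W)).filter
      (fun y => ∀ k, k ∉ ({i, j} : Finset (Fin d)) → y k = x k)),
      ((u i : ℝ) - x i) * f (0, Pi.single i 1) + ((u j : ℝ) - x j) * f (0, Pi.single j 1) = 0 := by
    intro u hu
    rw [mem_filter, mem_filter] at hu
    have h1 : f (phi u) = 0 := hf hu.1.2
    have h2 : f (phi x) = 0 := hf (mem_filter.1 hx).2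
    rw [hphi] at h1 h2
    have h3 : ∑ k, ((u k : ℝ) - x k) * f (0, Pi.single k 1) = 0 := by
      have : ∑ k, ((u k : ℝ) - x k) * f (0, Pi.single k 1) =
        ∑ k, (u k : ℝ) * f (0, Pi.single k 1) - ∑ k, (x k : ℝ) * f (0, Pi.single k 1) := by
        rw [← sum_sub_distrib]; refine sum_congr rfl ?_; intro k _; ring
      rw [this]; linarith
    rw [← sum_subset (subset_univ ({i, j} : Finset (Fin d))), sum_pair hji.symm] at h3
    · exact h3
    intro k _ hk
    rw [hu.2 k hk]; simp
  have key2 : ∀ u ∈ (((Sph phi Qf (Gr d n) l).filter (fun p => phi p ∈ W)).filter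
      (fun y => ∀ k, k ∉ ({i, j} : Finset (Fin d)) → y k = x k)),
      (u i : ℝ) = x i - ((u j : ℝ) - x j) * f (0, Pi.single j 1) / f (0, Pi.single i 1) := by
    intro u hu
    have := key u hu
    field_simp
    linarith
  apply collinear_card l
  · intro y hy
    exact (mem_Sph.1 (mem_filter.1 (mem_filter.1 hy).1).1).2
  · intro u hu v hv w hw huv
    have ku := key2 u hu
    have kv := key2 v hv
    have kw := key2 w hw
    replace hu := (mem_filter.1 hu).2
    replace hv := (mem_filter.1 hv).2
    replace hw := (mem_filter.1 hw).2
    have hj : (v j : ℝ) - u j ≠ 0 := by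
      intro h
      apply huv
      have h6 : (v j : ℝ) = u j := by linarith
      funext k
      by_cases hk : k = j
      · subst hk
        exact_mod_cast h6.symm
      · by_cases hk' : k = i
        · subst hk'
          rw [h6, ← ku] at kv
          exact_mod_cast kv.symm
        · rw [hu k (by simp [hk, hk']), hv k (by simp [hk, hk'])]
    refine ⟨((w j : ℝ) - u j) / ((v j : ℝ) - u j), ?_⟩
    intro k
    by_cases hk : k = j
    · subst hk; field_simp
    · by_cases hk' : k = i
      · subst hk'
        rw [ku, kv, kw]; field_simp; ring
      · rw [hu k (by simp [hk, hk']), hv k (by simp [hk, hk']), hw k (by simp [hk, hk'])]; simp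

end Geometry


section Geometry2
open Finset Module
open scoped Classical

theorem small_span {d : ℕ} (G : Finset (Fin d → ℤ)) (l : VV d →ₗ[ℝ] ℝ) (k : ℕ) (hk : k < 3)
    (u : Fin k → (Fin d → ℤ)) (hu : ∀ i, u i ∈ Sph phi Qf G l) :
    #((Sph phi Qf G l).filter (fun p => phi p ∈ Submodule.span ℝ (Set.range (phi ∘ u)))) ≤ 2 := by
  interval_cases k
  · have : (Sph phi Qf G l).filter (fun p => phi p ∈ Submodule.span ℝ (Set.range (phi ∘ u))) = ∅ := by
      rw [filter_eq_empty_iff]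
      intro p _ hp
      rw [Set.range_eq_empty, Submodule.span_empty, Submodule.mem_bot] at hp
      have := congrArg Prod.fst hp
      simp [phi] at this
    rw [this]; simp
  · refine (card_le_card (t := {u 0}) ?_).trans (by simp)
    intro p hp
    rw [mem_filter] at hp
    have h := hp.2
    rw [Submodule.mem_span_range_iff_exists_fun] at h
    obtain ⟨c, hc⟩ := h
    simp only [Fin.sum_univ_one, Function.comp_apply] at hc
    have h1 : c 0 = 1 := by
      have := congrArg Prod.fst hc
      simpa [phi] using this
    rw [h1, one_smul] at hc
    rw [mem_singleton]
    exact (phi_inj hc).symm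
  · refine (card_le_card (t := {u 0, u 1}) ?_).trans card_le_two
    intro p hp
    rw [mem_filter] at hp
    have h := hp.2
    rw [Submodule.mem_span_range_iff_exists_fun] at h
    obtain ⟨c, hc⟩ := h
    simp only [Fin.sum_univ_two, Function.comp_apply] at hc
    have h1 : c 0 + c 1 = 1 := by
      have := congrArg Prod.fst hc
      simpa [phi] using this
    have h2 : ∀ k, c 0 * u 0 k + c 1 * u 1 k = p k := by
      intro k
      have := congrFun (congrArg Prod.snd hc) k
      simpa [phi] using this
    rcases collinear_lemma l (u 0) (u 1) p (mem_Sph.1 (hu 0)).2 (mem_Sph.1 (hu 1)).2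
      (mem_Sph.1 hp.1).2 (c 1) (fun k => by rw [← h2 k]; linear_combination (u 0 k : ℝ) * h1) with h | h | h
    · have : p = u 0 := by
        funext k
        have h3 := h2 k
        rw [← h, ← add_mul, h1, one_mul] at h3
        exact_mod_cast h3.symm
      simp [this]
    · simp [h]
    · simp [h]

theorem sum_sq_le {d n : ℕ} {x y : Fin d → ℤ} (hx : x ∈ Gr d n) (hy : y ∈ Gr d n) :
    ∑ k, (x k - y k) ^ 2 ≤ (d : ℤ) * n ^ 2 := by
  calc ∑ k, (x k - y k) ^ 2 ≤ ∑ _k : Fin d, (n : ℤ) ^ 2 := by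
        refine sum_le_sum ?_
        intro k _
        have h1 := mem_Gr.1 hx k
        have h2 := mem_Gr.1 hy k
        exact sq_le_sq' (by omega) (by omega)
    _ = _ := by simp

theorem sum_sq_pos {d : ℕ} {x y : Fin d → ℤ} (h : x ≠ y) : 0 < ∑ k, (x k - y k) ^ 2 := by
  refine lt_of_le_of_ne (sum_nonneg (fun _ _ => sq_nonneg _)) ?_
  intro h0
  apply h
  have h1 := (sum_eq_zero_iff_of_nonneg (fun k _ => sq_nonneg (x k - y k))).1 h0.symm
  funext k
  have := h1 k (mem_univ _)
  have : x k - y k = 0 := by simpa using this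
  omega

theorem circle_card {d n : ℕ} (l : VV d →ₗ[ℝ] ℝ) (u : Fin 3 → (Fin d → ℤ))
    (hi : LinearIndependent ℝ (phi ∘ u)) (hu : ∀ i, u i ∈ Sph phi Qf (Gr d n) l) :
    ∃ m : ℕ, 0 < m ∧ m ≤ (d * n ^ 2) ^ 4 ∧
    #((Sph phi Qf (Gr d n) l).filter (fun p => phi p ∈ Submodule.span ℝ (Set.range (phi ∘ u)))) ≤
      10 * (#m.divisors) ^ 3 := by
  have hne : ∀ i j, i ≠ j → u i ≠ u j := by
    intro i j hij h
    exact hij (hi.injective (by simp [h]))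
  have hG : ∀ i, u i ∈ Gr d n := fun i => (mem_Sph.1 (hu i)).1
  set E : ℤ := ∑ k, (u 1 k - u 0 k) ^ 2 with hE
  set G' : ℤ := ∑ k, (u 2 k - u 0 k) ^ 2 with hG'
  set F : ℤ := ∑ k, (u 1 k - u 0 k) * (u 2 k - u 0 k) with hF
  have hEpos : 0 < E := sum_sq_pos (hne 1 0 (by decide))
  have hGpos : 0 < G' := sum_sq_pos (hne 2 0 (by decide))
  have hH : ∑ k, (u 1 k - u 2 k) ^ 2 = E + G' - 2 * F := by
    rw [hE, hG', hF, mul_sum, ← sum_add_distrib, ← sum_sub_distrib]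
    refine sum_congr rfl ?_
    intro k _; ring
  have hHpos : 0 < E + G' - 2 * F := by rw [← hH]; exact sum_sq_pos (hne 1 2 (by decide))
  have hEle : E ≤ d * n ^ 2 := sum_sq_le (hG 1) (hG 0)
  have hGle : G' ≤ d * n ^ 2 := sum_sq_le (hG 2) (hG 0)
  have hHle : E + G' - 2 * F ≤ d * n ^ 2 := by rw [← hH]; exact sum_sq_le (hG 1) (hG 2)
  set Δ : ℤ := E * G' - F ^ 2 with hΔ
  have hΔpos : 0 < Δ := by
    have h1 : ∑ k, (G' * (u 1 k - u 0 k) - F * (u 2 k - u 0 k)) ^ 2 = G' * Δ := by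
      have : ∀ k, (G' * (u 1 k - u 0 k) - F * (u 2 k - u 0 k)) ^ 2 =
        G' ^ 2 * (u 1 k - u 0 k) ^ 2 - 2 * G' * F * ((u 1 k - u 0 k) * (u 2 k - u 0 k))
          + F ^ 2 * (u 2 k - u 0 k) ^ 2 := by intro k; ring
      simp only [this]
      rw [sum_add_distrib, sum_sub_distrib, ← mul_sum, ← mul_sum, ← mul_sum, ← hE, ← hF, ← hG', hΔ]
      ring
    have h2 : 0 < ∑ k, (G' * (u 1 k - u 0 k) - F * (u 2 k - u 0 k)) ^ 2 := by
      refine lt_of_le_of_ne (sum_nonneg (fun _ _ => sq_nonneg _)) ?_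
      intro h0
      have h3 := (sum_eq_zero_iff_of_nonneg (fun k _ => sq_nonneg _)).1 h0.symm
      rw [Fintype.linearIndependent_iff] at hi
      have h4 := hi ![(F : ℝ) - G', G', -F] (by
        simp only [Fin.sum_univ_three, Function.comp_apply]
        refine Prod.ext ?_ ?_
        · simp [phi]
        · funext k
          have h5 : G' * (u 1 k - u 0 k) - F * (u 2 k - u 0 k) = 0 := by
            simpa using h3 k (mem_univ _)
          have h6 : (G' : ℝ) * (u 1 k - u 0 k) - F * (u 2 k - u 0 k) = 0 := by exact_mod_cast h5
          simp [phi]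
          linear_combination h6) 1
      simp at h4
      omega
    rw [h1] at h2
    exact (mul_pos_iff_of_pos_left hGpos).1 h2
  set m : ℤ := G' ^ 2 * E * (E + G' - 2 * F) with hm
  have hmpos : 0 < m := by positivity
  refine ⟨m.toNat, by omega, ?_, ?_⟩
  · rw [Int.toNat_le]
    push_cast
    calc m = G' * G' * E * (E + G' - 2 * F) := by rw [hm]; ring
      _ ≤ (d * n ^ 2) * (d * n ^ 2) * (d * n ^ 2) * (d * n ^ 2) := by gcongr
      _ = _ := by ring
  set S := (Sph phi Qf (Gr d n) l).filter (fun p => phi p ∈ Submodule.span ℝ (Set.range (phi ∘ u))) with hS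
  let s : (Fin d → ℤ) → ℤ := fun p => ∑ k, (p k - u 0 k) * (u 1 k - u 0 k)
  let t : (Fin d → ℤ) → ℤ := fun p => ∑ k, (p k - u 0 k) * (u 2 k - u 0 k)
  let f : (Fin d → ℤ) → ℤ × ℤ := fun p =>
    (2 * (G' * s p - F * t p) - G' * (E - F), 2 * t p - G')
  have key : ∀ p ∈ S, ∃ α β : ℝ, (∀ k, (p k : ℝ) - u 0 k = α * (u 1 k - u 0 k) + β * (u 2 k - u 0 k)) ∧
      (s p : ℝ) = α * E + β * F ∧ (t p : ℝ) = α * F + β * G' ∧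
      α ^ 2 * E + 2 * α * β * F + β ^ 2 * G' = α * E + β * G' := by
    intro p hp
    rw [hS, mem_filter] at hp
    obtain ⟨c, hc⟩ := (Submodule.mem_span_range_iff_exists_fun ℝ).1 hp.2
    simp only [Fin.sum_univ_three, Function.comp_apply] at hc
    have h1 : c 0 + c 1 + c 2 = 1 := by
      have := congrArg Prod.fst hc
      simpa [phi] using this
    have h2 : ∀ k, c 0 * u 0 k + c 1 * u 1 k + c 2 * u 2 k = p k := by
      intro k
      have := congrFun (congrArg Prod.snd hc) k
      simpa [phi] using this
    have h3 : ∀ k, (p k : ℝ) - u 0 k = c 1 * (u 1 k - u 0 k) + c 2 * (u 2 k - u 0 k) := by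
      intro k; rw [← h2 k]; linear_combination (u 0 k : ℝ) * h1
    have h4 : Qf p = c 0 * Qf (u 0) + c 1 * Qf (u 1) + c 2 * Qf (u 2) := by
      rw [(mem_Sph.1 hp.1).2, ← hc, map_add, map_add, map_smul, map_smul, map_smul,
        (mem_Sph.1 (hu 0)).2, (mem_Sph.1 (hu 1)).2, (mem_Sph.1 (hu 2)).2]
      simp
    refine ⟨c 1, c 2, h3, ?_, ?_, ?_⟩
    · simp only [s, hE, hF]
      push_cast
      rw [mul_sum, mul_sum, ← sum_add_distrib]
      refine sum_congr rfl ?_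
      intro k _
      rw [h3 k]; ring
    · simp only [t, hG', hF]
      push_cast
      rw [mul_sum, mul_sum, ← sum_add_distrib]
      refine sum_congr rfl ?_
      intro k _
      rw [h3 k]; ring
    · have h5 : c 0 = 1 - c 1 - c 2 := by linarith
      have h6 : (c 1 ^ 2 * E + 2 * c 1 * c 2 * F + c 2 ^ 2 * G') - (c 1 * E + c 2 * G') =
          Qf p - (c 0 * Qf (u 0) + c 1 * Qf (u 1) + c 2 * Qf (u 2)) := by
        simp only [hE, hF, hG', Qf]
        push_cast
        simp only [mul_sum]
        simp only [← sum_add_distrib, ← sum_sub_distrib]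
        refine sum_congr rfl ?_
        intro k _
        have h7 : (p k : ℝ) = u 0 k + c 1 * (u 1 k - u 0 k) + c 2 * (u 2 k - u 0 k) := by
          linear_combination h3 k
        rw [h7, h5]; ring
      rw [h4, sub_self] at h6
      linarith
  have himg : #S = #(S.image f) := by
    rw [card_image_of_injOn]
    intro p hp q hq hpq
    obtain ⟨α, β, hp1, hp2, hp3, -⟩ := key p hp
    obtain ⟨α', β', hq1, hq2, hq3, -⟩ := key q hq
    simp only [f, Prod.mk.injEq] at hpq
    have ht : t p = t q := by omega
    have hs' : G' * s p = G' * s q := by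
      have h := hpq.1
      rw [ht] at h
      linarith
    have hs : s p = s q := mul_left_cancel₀ hGpos.ne' hs'
    have hΔr : ((E : ℝ) * G' - F ^ 2) ≠ 0 := by
      have : (0 : ℝ) < (Δ : ℝ) := by exact_mod_cast hΔpos
      rw [hΔ] at this
      push_cast at this
      exact this.ne'
    have hGr : (G' : ℝ) ≠ 0 := by exact_mod_cast hGpos.ne'
    rw [hs, hq2] at hp2
    rw [ht, hq3] at hp3
    have hα : α = α' := by
      apply mul_right_cancel₀ hΔr
      linear_combination (-(G' : ℝ)) * hp2 + F * hp3
    have hβ : β = β' := by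
      rw [hα] at hp3
      apply mul_right_cancel₀ hGr
      linarith
    funext k
    have h8 := hp1 k
    rw [hα, hβ, ← hq1 k] at h8
    have h9 : (p k : ℝ) = q k := by linarith
    exact_mod_cast h9
  rw [himg]
  refine rep_bound m.toNat (by omega) 1 Δ one_pos hΔpos _ ?_
  intro z hz
  rw [mem_image] at hz
  obtain ⟨p, hp, rfl⟩ := hz
  obtain ⟨α, β, hp1, hp2, hp3, hp4⟩ := key p hp
  rw [Int.toNat_of_nonneg hmpos.le]
  have : ((1 * (2 * (G' * s p - F * t p) - G' * (E - F)) ^ 2 + Δ * (2 * t p - G') ^ 2 : ℤ) : ℝ) = (m : ℤ) := by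
    rw [hm, hΔ]
    push_cast
    rw [hp2, hp3]
    linear_combination 4 * G' * ((E : ℝ) * G' - F ^ 2) * hp4
  exact_mod_cast this

theorem cell_tuples {d n L t' : ℕ} (hL : 0 < L) :
    #((Fintype.piFinset (fun _ : Fin (t' + 1) => Gr d n)).filter
      (fun u => ∀ i, (fun j => u i j / (L : ℤ)) = (fun j => u 0 j / (L : ℤ)))) ≤
      n ^ d * (L ^ d) ^ t' := by
  have hT : #((Gr d n) ×ˢ (Fintype.piFinset (fun _ : Fin t' =>
      Fintype.piFinset (fun _ : Fin d => Finset.Ico 0 (L : ℤ))))) = n ^ d * (L ^ d) ^ t' := by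
    rw [card_product, card_Gr]
    simp
  rw [← hT]
  refine card_le_card_of_injOn (fun u => (u 0, fun i j => u i.succ j % (L : ℤ))) ?_ ?_
  · intro u hu
    rw [mem_coe, mem_filter, Fintype.mem_piFinset] at hu
    simp only [coe_product, Set.mem_prod, mem_coe, Fintype.mem_piFinset, Finset.mem_Ico]
    refine ⟨hu.1 0, fun i j => ⟨Int.emod_nonneg _ (by omega), Int.emod_lt_of_pos _ (by omega)⟩⟩
  · intro u hu v hv huv
    rw [mem_coe, mem_filter] at hu hv
    simp only [Prod.mk.injEq] at huv
    funext i
    refine Fin.cases huv.1 ?_ i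
    intro i
    funext j
    have h1 := congrFun (congrFun huv.2 i) j
    have h2 := congrFun (hu.2 i.succ) j
    have h3 := congrFun (hv.2 i.succ) j
    rw [huv.1, ← h3] at h2
    rw [← Int.mul_ediv_add_emod (u i.succ j) L, h1, h2, Int.mul_ediv_add_emod]

theorem cell_class {d n L s : ℕ} (hd : 0 < d) (hL : 0 < L) (hs : n / L ≤ s) (hs1 : 1 ≤ s)
    (l : VV d →ₗ[ℝ] ℝ) : ∃ Φ : (Fin d → ℤ) → ((Fin d → Bool) × (Fin d → ℤ)),
      (∀ x ∈ Sph phi Qf (Gr d n) l, ∀ y ∈ Sph phi Qf (Gr d n) l, Φ x = Φ y →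
        (fun j => x j / (L : ℤ)) = (fun j => y j / (L : ℤ))) ∧
      #((Sph phi Qf (Gr d n) l).image Φ) ≤ 10 ^ d * s ^ (d - 1) := by
  let i0 : Fin d := ⟨0, hd⟩
  let sg : (Fin d → ℤ) → Fin d → ℤ := fun x i => if cen l i ≤ x i then 1 else -1
  refine ⟨fun x => (fun i => decide (cen l i ≤ x i),
    fun i => sg x i * (x i / (L : ℤ)) - sg x i0 * (x i0 / (L : ℤ))), ?_, ?_⟩
  · -- one direction of the comparison
    have aux : ∀ x ∈ Sph phi Qf (Gr d n) l, ∀ y ∈ Sph phi Qf (Gr d n) l,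
        (∀ i, sg x i = sg y i) → ¬ (∀ i, sg x i * (y i / (L : ℤ)) < sg x i * (x i / (L : ℤ))) := by
      intro x hx y hy hsg hlt
      have e1 := sphere_eq l x (mem_Sph.1 hx).2
      have e2 := sphere_eq l y (mem_Sph.1 hy).2
      have : ∑ i, ((y i : ℝ) - cen l i) ^ 2 < ∑ i, ((x i : ℝ) - cen l i) ^ 2 := by
        refine sum_lt_sum_of_nonempty ⟨i0, mem_univ _⟩ ?_
        intro i _
        have h1 := hlt i
        have h2 := hsg i
        by_cases hc : cen l i ≤ x i
        · have hc' : cen l i ≤ y i := by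
            by_contra hc'
            simp [sg, hc, hc'] at h2
          simp only [sg, hc, if_true, one_mul] at h1
          have h3 : y i < x i := by
            by_contra hcon
            push Not at hcon
            have := Int.ediv_le_ediv (c := (L : ℤ)) (by omega) hcon
            omega
          have h4 : (y i : ℝ) < x i := by exact_mod_cast h3
          nlinarith
        · have hc' : ¬ cen l i ≤ y i := by
            intro hc'
            simp [sg, hc, hc'] at h2
          simp only [sg, hc, if_false] at h1
          have h3 : x i < y i := by
            by_contra hcon
            push Not at hcon
            have := Int.ediv_le_ediv (c := (L : ℤ)) (by omega) hcon
            omega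
          have h4 : (x i : ℝ) < y i := by exact_mod_cast h3
          push Not at hc hc'
          nlinarith
      linarith
    intro x hx y hy hxy
    simp only [Prod.mk.injEq] at hxy
    have hsg : ∀ i, sg x i = sg y i := by
      intro i
      have := congrFun hxy.1 i
      simp only [decide_eq_decide] at this
      simp only [sg, this]
    have hdiff : ∀ i, sg x i * (x i / (L : ℤ)) - sg x i0 * (x i0 / (L : ℤ)) =
        sg x i * (y i / (L : ℤ)) - sg x i0 * (y i0 / (L : ℤ)) := by
      intro i
      have := congrFun hxy.2 i
      rw [← hsg i, ← hsg i0] at this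
      exact this
    rcases lt_trichotomy (sg x i0 * (x i0 / (L : ℤ))) (sg x i0 * (y i0 / (L : ℤ))) with h | h | h
    · exfalso
      refine aux y hy x hx (fun i => (hsg i).symm) ?_
      intro i
      rw [← hsg i]
      have := hdiff i
      linarith
    · funext i
      have h1 := hdiff i
      rw [h] at h1
      have h2 : sg x i * (x i / (L : ℤ)) = sg x i * (y i / (L : ℤ)) := by linarith
      refine mul_left_cancel₀ ?_ h2
      simp only [sg]
      split_ifs <;> simp
    · exfalso
      refine aux x hx y hy hsg ?_
      intro i
      have := hdiff i
      linarith
  · have hT : #((univ : Finset (Fin d → Bool)) ×ˢ Fintype.piFinset (fun i : Fin d =>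
        if i = i0 then ({0} : Finset ℤ) else Finset.Icc (-2 * (s : ℤ)) (2 * s))) =
        2 ^ d * (4 * s + 1) ^ (d - 1) := by
      rw [card_product, Fintype.card_piFinset]
      congr 1
      · simp
      · have : ∀ i : Fin d, #(if i = i0 then ({0} : Finset ℤ) else Finset.Icc (-2 * (s : ℤ)) (2 * s)) =
            if i = i0 then 1 else 4 * s + 1 := by
          intro i
          split_ifs
          · simp
          · rw [Int.card_Icc]; omega
        simp only [this]
        rw [prod_ite]
        simp [filter_ne', card_erase_of_mem]
    have h1 : #((Sph phi Qf (Gr d n) l).image (fun x => ((fun i => decide (cen l i ≤ x i),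
        fun i => sg x i * (x i / (L : ℤ)) - sg x i0 * (x i0 / (L : ℤ))) :
          (Fin d → Bool) × (Fin d → ℤ)))) ≤ 2 ^ d * (4 * s + 1) ^ (d - 1) := by
      rw [← hT]
      apply card_le_card
      intro z hz
      rw [mem_image] at hz
      obtain ⟨x, hx, rfl⟩ := hz
      rw [mem_product]
      refine ⟨mem_univ _, ?_⟩
      rw [Fintype.mem_piFinset]
      have hk : ∀ i, 0 ≤ x i / (L : ℤ) ∧ x i / (L : ℤ) ≤ s := by
        intro i
        have h2 := mem_Gr.1 (mem_Sph.1 hx).1 i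
        refine ⟨Int.ediv_nonneg (by omega) (by omega), ?_⟩
        have h3 := Int.ediv_le_ediv (c := (L : ℤ)) (by omega) h2.2
        have h4 : ((n / L : ℕ) : ℤ) ≤ s := by exact_mod_cast hs
        push_cast at h4
        omega
      have hb : ∀ i, -(s : ℤ) ≤ sg x i * (x i / (L : ℤ)) ∧ sg x i * (x i / (L : ℤ)) ≤ s := by
        intro i
        have := hk i
        simp only [sg]
        split_ifs <;> constructor <;> linarith
      intro i
      by_cases h : i = i0
      · simp [h]
      · simp only [h, if_false, Finset.mem_Icc]
        have h5 := hb i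
        have h6 := hb i0
        constructor <;> linarith
    refine h1.trans ?_
    calc 2 ^ d * (4 * s + 1) ^ (d - 1) ≤ 2 ^ d * (5 * s) ^ (d - 1) := by
          gcongr; omega
      _ = 2 ^ d * 5 ^ (d - 1) * s ^ (d - 1) := by rw [mul_pow]; ring
      _ ≤ 2 ^ d * 5 ^ d * s ^ (d - 1) := by gcongr <;> omega
      _ = _ := by rw [← mul_pow]; norm_num

end Geometry2


section Dyadic
open Finset Module
open scoped Classical

set_option maxHeartbeats 1000000 in
theorem dyadic_bound {d n t' : ℕ} (hd : 2 ≤ d) (hn : 1 ≤ n) (ht : t' + 1 ≤ d) (M r : ℕ) (hM1 : 1 ≤ M)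
    (hM : ∀ l : VV d →ₗ[ℝ] ℝ, ∀ k < t' + 1, ∀ u : Fin k → (Fin d → ℤ), LinearIndependent ℝ (phi ∘ u) →
      (∀ i, u i ∈ Sph phi Qf (Gr d n) l) →
      #((Sph phi Qf (Gr d n) l).filter (fun p => phi p ∈ Submodule.span ℝ (Set.range (phi ∘ u)))) ≤ M)
    (ell : (Fin (d + 1) → (Fin d → ℤ)) → (VV d →ₗ[ℝ] ℝ))
    (hell : ∀ q : Fin (d + 1) → (Fin d → ℤ), LinearIndependent ℝ (phi ∘ q) →
      ∀ i, Qf (q i) = ell q (phi (q i))) (hr0 : 0 < r) :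
    r * #((Fintype.piFinset (fun _ : Fin (d + 1) => Gr d n)).filter
      (fun q => LinearIndependent ℝ (phi ∘ q) ∧
      r ≤ #(Sph phi Qf (Gr d n) (ell q)) ∧ #(Sph phi Qf (Gr d n) (ell q)) < 2 * r)) ≤
    (2 * 20 ^ d * (4 ^ (t' + 1) * 10 ^ (d * t') * 2 ^ (d * t') *
      (Fintype.card (Fin (d - t') ⊕ Fin (t' + 1) ≃ Fin (d + 1))) + 1)) * M *
      n ^ (d - 1 - t') * n ^ (d ^ 2 + d) := by
  set E := (Fintype.piFinset (fun _ : Fin (d + 1) => Gr d n)).filter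
      (fun q => LinearIndependent ℝ (phi ∘ q) ∧
      r ≤ #(Sph phi Qf (Gr d n) (ell q)) ∧ #(Sph phi Qf (Gr d n) (ell q)) < 2 * r) with hE
  set K0 := Fintype.card (Fin (d - t') ⊕ Fin (t' + 1) ≃ Fin (d + 1)) with hK0
  set K1 := 4 ^ (t' + 1) * 10 ^ (d * t') * 2 ^ (d * t') * K0 with hK1
  have hEtriv : #E ≤ n ^ (d ^ 2 + d) := by
    refine (card_filter_le _ _).trans ?_
    rw [Fintype.card_piFinset_const, card_Gr, ← pow_mul]
    apply le_of_eq; congr 1; ring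
  rcases E.eq_empty_or_nonempty with h0 | ⟨q0, hq0⟩
  · rw [h0]; simp
  have hr1 : r ≤ 2 * n ^ (d - 1) := (mem_filter.1 hq0).2.2.1.trans (sph_card (by omega) _)
  set s := Nat.findGreatest (fun s => 2 * 10 ^ d * s ^ (d - 1) * M ≤ r) n with hs
  by_cases hs0 : s = 0
  · have h1 := (Nat.findGreatest_eq_zero_iff.1 (hs ▸ hs0)) (n := 1) one_pos hn
    simp only [one_pow, mul_one, not_le] at h1
    calc r * #E ≤ (2 * 10 ^ d * M) * n ^ (d ^ 2 + d) := Nat.mul_le_mul h1.le hEtriv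
      _ ≤ (2 * 20 ^ d * (K1 + 1)) * M * n ^ (d - 1 - t') * n ^ (d ^ 2 + d) := by
        refine Nat.mul_le_mul_right _ ?_
        calc 2 * 10 ^ d * M = 2 * 10 ^ d * 1 * M * 1 := by ring
          _ ≤ 2 * 20 ^ d * (K1 + 1) * M * n ^ (d - 1 - t') := by
            gcongr
            · norm_num
            · omega
            · exact Nat.one_le_pow _ _ hn
  have hs1 : 1 ≤ s := by omega
  have hsn : s ≤ n := Nat.findGreatest_le n
  have hsP : 2 * 10 ^ d * s ^ (d - 1) * M ≤ r :=
    Nat.findGreatest_of_ne_zero (P := fun s => 2 * 10 ^ d * s ^ (d - 1) * M ≤ r) hs.symm hs0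
  have hrs : r ≤ 2 * 20 ^ d * s ^ (d - 1) * M := by
    by_cases hsn' : s = n
    · calc r ≤ 2 * n ^ (d - 1) := hr1
        _ = 2 * 1 * s ^ (d - 1) * 1 := by rw [hsn']; ring
        _ ≤ _ := by
          gcongr
          exact Nat.one_le_pow _ _ (by norm_num)
    · have h2 := Nat.findGreatest_is_greatest (P := fun s => 2 * 10 ^ d * s ^ (d - 1) * M ≤ r)
        (n := n) (k := s + 1) (by omega) (by omega)
      simp only [not_le] at h2
      refine h2.le.trans ?_
      calc 2 * 10 ^ d * (s + 1) ^ (d - 1) * M ≤ 2 * 10 ^ d * (2 * s) ^ (d - 1) * M := by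
            gcongr; omega
        _ = 2 * (10 ^ d * 2 ^ (d - 1)) * s ^ (d - 1) * M := by rw [mul_pow]; ring
        _ ≤ 2 * (10 ^ d * 2 ^ d) * s ^ (d - 1) * M := by gcongr <;> omega
        _ = _ := by rw [← mul_pow]; norm_num
  set L := n / s + 1 with hL
  have hnL : n / L ≤ s := by
    apply Nat.le_of_lt
    apply Nat.div_lt_of_lt_mul
    rw [hL, mul_comm]
    exact Nat.lt_mul_div_succ n hs1
  have hsL : s * L ≤ 2 * n := by
    have := Nat.mul_div_le n s
    rw [hL, mul_add, mul_one]; omega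
  have hL0 : 0 < L := Nat.succ_pos _
  have hcells := cell_tuples (d := d) (n := n) (t' := t') hL0
  have hclass : ∀ l : VV d →ₗ[ℝ] ℝ, ∃ Φ : (Fin d → ℤ) → ((Fin d → Bool) × (Fin d → ℤ)),
      (∀ x ∈ Sph phi Qf (Gr d n) l, ∀ y ∈ Sph phi Qf (Gr d n) l, Φ x = Φ y →
        (fun j => x j / (L : ℤ)) = (fun j => y j / (L : ℤ))) ∧
      #(@image _ _ (fun a b => Classical.propDecidable (a = b)) Φ (Sph phi Qf (Gr d n) l)) ≤
        10 ^ d * s ^ (d - 1) := by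
    intro l
    obtain ⟨Φ, h1, h2⟩ := cell_class (d := d) (by omega) hL0 hnL hs1 l
    refine ⟨Φ, h1, ?_⟩
    convert h2
  have core := core_bound (β := (Fin d → Bool) × (Fin d → ℤ)) phi Qf (Gr d n) (t' := t') (m := d - t')
    (finrank_VV d) (by omega)
    M (10 ^ d * s ^ (d - 1)) (n ^ d * (L ^ d) ^ t') r hM (fun p j => p j / (L : ℤ))
    (by convert hcells) hclass ell hell
    (by refine le_trans (le_of_eq ?_) hsP; ring) hr0
  rw [← hE, ← hK0, card_Gr] at core
  have h3 : s ^ t' * #E ≤ K1 * n ^ (d ^ 2 + d) := by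
    calc s ^ t' * #E ≤ s ^ t' * (4 ^ (t' + 1) * (10 ^ d * s ^ (d - 1)) ^ t' * K0 *
          (n ^ d * (L ^ d) ^ t') * (n ^ d) ^ (d - t')) := Nat.mul_le_mul_left _ core
      _ = 4 ^ (t' + 1) * 10 ^ (d * t') * K0 * ((s * s ^ (d - 1)) ^ t' * (L ^ d) ^ t') *
          (n ^ d * (n ^ d) ^ (d - t')) := by
        rw [mul_pow (10 ^ d), mul_pow s, ← pow_mul 10]; ring
      _ = 4 ^ (t' + 1) * 10 ^ (d * t') * K0 * (s * L) ^ (d * t') *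
          (n ^ d * (n ^ d) ^ (d - t')) := by
        rw [← pow_succ', Nat.sub_add_cancel (by omega), ← mul_pow, ← mul_pow, ← pow_mul]
      _ ≤ 4 ^ (t' + 1) * 10 ^ (d * t') * K0 * (2 * n) ^ (d * t') *
          (n ^ d * (n ^ d) ^ (d - t')) := by gcongr
      _ = K1 * (n ^ (d * t') * (n ^ d * (n ^ d) ^ (d - t'))) := by
        rw [hK1, mul_pow]; ring
      _ = K1 * n ^ (d ^ 2 + d) := by
        congr 1
        rw [← pow_mul, ← pow_add, ← pow_add]
        congr 1
        obtain ⟨m, rfl⟩ : ∃ m, d = t' + m := ⟨d - t', by omega⟩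
        rw [Nat.add_sub_cancel_left]; ring
  calc r * #E ≤ (2 * 20 ^ d * s ^ (d - 1) * M) * #E := Nat.mul_le_mul_right _ hrs
    _ = 2 * 20 ^ d * M * s ^ (d - 1 - t') * (s ^ t' * #E) := by
      have : s ^ (d - 1) = s ^ (d - 1 - t') * s ^ t' := by
        rw [← pow_add]; congr 1; omega
      rw [this]; ring
    _ ≤ 2 * 20 ^ d * M * n ^ (d - 1 - t') * ((K1 + 1) * n ^ (d ^ 2 + d)) := by
      refine Nat.mul_le_mul (by gcongr) ?_
      exact h3.trans (Nat.mul_le_mul_right _ (Nat.le_succ K1))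
    _ = _ := by ring

theorem total_bound {d n t' : ℕ} (hd : 2 ≤ d) (hn : 1 ≤ n) (ht : t' + 1 ≤ d) (M : ℕ) (hM1 : 1 ≤ M)
    (hM : ∀ l : VV d →ₗ[ℝ] ℝ, ∀ k < t' + 1, ∀ u : Fin k → (Fin d → ℤ), LinearIndependent ℝ (phi ∘ u) →
      (∀ i, u i ∈ Sph phi Qf (Gr d n) l) →
      #((Sph phi Qf (Gr d n) l).filter (fun p => phi p ∈ Submodule.span ℝ (Set.range (phi ∘ u)))) ≤ M)
    (ell : (Fin (d + 1) → (Fin d → ℤ)) → (VV d →ₗ[ℝ] ℝ))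
    (hell : ∀ q : Fin (d + 1) → (Fin d → ℤ), LinearIndependent ℝ (phi ∘ q) →
      ∀ i, Qf (q i) = ell q (phi (q i))) :
    ∑ q ∈ (Fintype.piFinset (fun _ : Fin (d + 1) => Gr d n)).filter
      (fun q => LinearIndependent ℝ (phi ∘ q)), #(Sph phi Qf (Gr d n) (ell q)) ≤
    (Nat.log 2 (n ^ d) + 1) * (2 * ((2 * 20 ^ d * (4 ^ (t' + 1) * 10 ^ (d * t') * 2 ^ (d * t') *
      (Fintype.card (Fin (d - t') ⊕ Fin (t' + 1) ≃ Fin (d + 1))) + 1)) * M *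
      n ^ (d - 1 - t') * n ^ (d ^ 2 + d))) := by
  set B := (2 * 20 ^ d * (4 ^ (t' + 1) * 10 ^ (d * t') * 2 ^ (d * t') *
      (Fintype.card (Fin (d - t') ⊕ Fin (t' + 1) ≃ Fin (d + 1))) + 1)) * M *
      n ^ (d - 1 - t') * n ^ (d ^ 2 + d) with hB
  set I := (Fintype.piFinset (fun _ : Fin (d + 1) => Gr d n)).filter
      (fun q => LinearIndependent ℝ (phi ∘ q)) with hI
  have hmaps : ∀ q ∈ I, Nat.log 2 #(Sph phi Qf (Gr d n) (ell q)) ∈ range (Nat.log 2 (n ^ d) + 1) := by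
    intro q _
    rw [mem_range, Nat.lt_succ_iff]
    apply Nat.log_mono_right
    rw [← card_Gr]
    exact card_filter_le _ _
  rw [← sum_fiberwise_of_maps_to hmaps]
  have : ∀ k ∈ range (Nat.log 2 (n ^ d) + 1),
      ∑ q ∈ I.filter (fun q => Nat.log 2 #(Sph phi Qf (Gr d n) (ell q)) = k),
        #(Sph phi Qf (Gr d n) (ell q)) ≤ 2 * B := by
    intro k _
    have hdy := dyadic_bound hd hn ht M (2 ^ k) hM1 hM ell hell (by positivity)
    rw [← hB] at hdy
    set E := (Fintype.piFinset (fun _ : Fin (d + 1) => Gr d n)).filter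
      (fun q => LinearIndependent ℝ (phi ∘ q) ∧
      2 ^ k ≤ #(Sph phi Qf (Gr d n) (ell q)) ∧ #(Sph phi Qf (Gr d n) (ell q)) < 2 * 2 ^ k) with hE
    have hin : ∀ q ∈ I.filter (fun q => Nat.log 2 #(Sph phi Qf (Gr d n) (ell q)) = k),
        q ∈ E ∧ #(Sph phi Qf (Gr d n) (ell q)) ≤ 2 * 2 ^ k := by
      intro q hq
      rw [mem_filter, hI, mem_filter] at hq
      obtain ⟨⟨hqG, hqi⟩, hk⟩ := hq
      have hpos : 0 < #(Sph phi Qf (Gr d n) (ell q)) :=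
        card_pos.2 ⟨q 0, mem_Sph.2 ⟨Fintype.mem_piFinset.1 hqG 0, hell q hqi 0⟩⟩
      have h1 : 2 ^ k ≤ #(Sph phi Qf (Gr d n) (ell q)) := by
        rw [← hk]; exact Nat.pow_log_le_self 2 hpos.ne'
      have h2 : #(Sph phi Qf (Gr d n) (ell q)) < 2 * 2 ^ k := by
        rw [← hk, ← pow_succ']; exact Nat.lt_pow_succ_log_self one_lt_two _
      exact ⟨mem_filter.2 ⟨hqG, hqi, h1, h2⟩, h2.le⟩
    calc _ ≤ ∑ _q ∈ I.filter (fun q => Nat.log 2 #(Sph phi Qf (Gr d n) (ell q)) = k), 2 * 2 ^ k :=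
          sum_le_sum (fun q hq => (hin q hq).2)
      _ = #(I.filter (fun q => Nat.log 2 #(Sph phi Qf (Gr d n) (ell q)) = k)) * (2 * 2 ^ k) := by
          rw [sum_const, smul_eq_mul]
      _ ≤ #E * (2 * 2 ^ k) := by
          gcongr
          exact fun q hq => (hin q hq).1
      _ = 2 * (2 ^ k * #E) := by ring
      _ ≤ 2 * B := by gcongr
  refine (sum_le_sum this).trans ?_
  rw [sum_const, smul_eq_mul, card_range]

end Dyadic


section Reduction
open Finset Module
open scoped Classical

theorem remove_one {V : Type*} [AddCommGroup V] [Module ℝ V] {m : ℕ} (v : Fin (m + 1) → V)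
    (h : finrank ℝ (Submodule.span ℝ (Set.range v)) ≤ m) :
    ∃ i : Fin (m + 1), Submodule.span ℝ (Set.range (v ∘ i.succAbove)) = Submodule.span ℝ (Set.range v) := by
  have hn : ¬ LinearIndependent ℝ v := by
    intro hv
    have := finrank_span_eq_card hv
    rw [Fintype.card_fin] at this
    omega
  rw [linearIndependent_iff_notMem_span] at hn
  push Not at hn
  obtain ⟨i, hi⟩ := hn
  refine ⟨i, le_antisymm (Submodule.span_mono (Set.range_comp_subset_range _ _)) ?_⟩
  have heq : v '' (Set.univ \ {i}) = Set.range (v ∘ i.succAbove) := by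
    rw [Set.range_comp, Fin.range_succAbove, Set.compl_eq_univ_sdiff]
  rw [heq] at hi
  rw [Submodule.span_le]
  rintro _ ⟨j, rfl⟩
  by_cases hj : j = i
  · subst hj; exact hi
  · obtain ⟨k, rfl⟩ := Fin.exists_succAbove_eq hj
    exact Submodule.subset_span ⟨k, rfl⟩

theorem tuple_ext {α : Type*} {m : ℕ} {s t : Fin (m + 1) → α} (i : Fin (m + 1))
    (h1 : s ∘ i.succAbove = t ∘ i.succAbove) (h2 : s i = t i) : s = t := by
  funext j
  by_cases hj : j = i
  · subst hj; exact h2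
  · obtain ⟨k, rfl⟩ := Fin.exists_succAbove_eq hj
    exact congrFun h1 k

/-- some functional fitting the given points, if there is one -/
noncomputable def fit {d k : ℕ} (u : Fin k → (Fin d → ℤ)) : VV d →ₗ[ℝ] ℝ :=
  if h : ∃ l : VV d →ₗ[ℝ] ℝ, ∀ i, Qf (u i) = l (phi (u i)) then h.choose else 0

theorem fit_spec {d k : ℕ} (u : Fin k → (Fin d → ℤ))
    (h : ∃ l : VV d →ₗ[ℝ] ℝ, ∀ i, Qf (u i) = l (phi (u i))) (i : Fin k) :
    Qf (u i) = fit u (phi (u i)) := by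
  rw [fit, dif_pos h]
  exact h.choose_spec i

theorem fit_indep {d : ℕ} (q : Fin (d + 1) → (Fin d → ℤ)) (hq : LinearIndependent ℝ (phi ∘ q))
    (i : Fin (d + 1)) : Qf (q i) = fit q (phi (q i)) := by
  apply fit_spec
  let b := basisOfLinearIndependentOfCardEqFinrank hq (by rw [finrank_VV, Fintype.card_fin])
  refine ⟨b.constr ℝ (fun i => Qf (q i)), ?_⟩
  intro j
  have : phi (q j) = b j := by simp [b]
  rw [this, Basis.constr_basis]

/-- tuples lying on a common (possibly degenerate) sphere -/
noncomputable def Tup (d n : ℕ) : Finset (Fin (d + 2) → (Fin d → ℤ)) :=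
  (Fintype.piFinset (fun _ => Gr d n)).filter
    (fun t => ∃ l : VV d →ₗ[ℝ] ℝ, ∀ i, Qf (t i) = l (phi (t i)))

theorem nondeg_count (d n : ℕ) :
    #((Tup d n).filter (fun t => Submodule.span ℝ (Set.range (phi ∘ t)) = ⊤)) ≤
      (d + 2) * ∑ q ∈ (Fintype.piFinset (fun _ : Fin (d + 1) => Gr d n)).filter
      (fun q => LinearIndependent ℝ (phi ∘ q)), #(Sph phi Qf (Gr d n) (fit q)) := by
  have hex : ∀ t : Fin (d + 2) → (Fin d → ℤ), ∃ i : Fin (d + 2),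
      Submodule.span ℝ (Set.range (phi ∘ t)) = ⊤ →
      Submodule.span ℝ (Set.range (phi ∘ t ∘ i.succAbove)) = ⊤ := by
    intro t
    by_cases h : Submodule.span ℝ (Set.range (phi ∘ t)) = ⊤
    · obtain ⟨i, hi⟩ := remove_one (phi ∘ t) (by rw [h, finrank_top, finrank_VV])
      exact ⟨i, fun _ => by rw [← Function.comp_assoc, hi, h]⟩
    · exact ⟨0, fun h' => absurd h' h⟩
  choose f hf using hex
  set I := (Fintype.piFinset (fun _ : Fin (d + 1) => Gr d n)).filter
      (fun q => LinearIndependent ℝ (phi ∘ q)) with hI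
  have hT : #((univ : Finset (Fin (d + 2))) ×ˢ I.sigma (fun q => Sph phi Qf (Gr d n) (fit q))) =
      (d + 2) * ∑ q ∈ I, #(Sph phi Qf (Gr d n) (fit q)) := by
    rw [card_product, card_sigma, card_univ, Fintype.card_fin]
  rw [← hT]
  refine card_le_card_of_injOn (fun t => (f t, ⟨t ∘ (f t).succAbove, t (f t)⟩)) ?_ ?_
  · intro t ht
    rw [mem_coe, mem_filter, Tup, mem_filter, Fintype.mem_piFinset] at ht
    obtain ⟨⟨htG, l, hl⟩, hsp⟩ := ht
    have hq := hf t hsp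
    have hli : LinearIndependent ℝ (phi ∘ t ∘ (f t).succAbove) :=
      linearIndependent_of_top_le_span_of_card_eq_finrank hq.ge (by rw [finrank_VV, Fintype.card_fin])
    have heq : l = fit (t ∘ (f t).succAbove) := by
      refine LinearMap.ext_on hq ?_
      rintro _ ⟨j, rfl⟩
      have h1 := hl ((f t).succAbove j)
      have h2 := fit_indep _ hli j
      exact h1.symm.trans h2
    rw [mem_coe, mem_product, mem_sigma]
    refine ⟨mem_univ _, mem_filter.2 ⟨Fintype.mem_piFinset.2 (fun j => htG _), hli⟩, ?_⟩
    simp only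
    rw [← heq]
    exact mem_Sph.2 ⟨htG _, hl _⟩
  · intro s _ t _ hst
    simp only [Prod.mk.injEq, Sigma.mk.injEq, heq_eq_eq] at hst
    obtain ⟨h1, h2, h3⟩ := hst
    rw [h1] at h2 h3
    exact tuple_ext (f t) h2 h3

theorem deg_count {d : ℕ} (n : ℕ) (hd : 2 ≤ d) :
    #((Tup d n).filter (fun t => ¬ Submodule.span ℝ (Set.range (phi ∘ t)) = ⊤)) ≤
      (d + 2) * ((d + 1) * ((n ^ d) ^ d * (2 * n ^ (d - 2)) ^ 2)) := by
  have hex : ∀ t : Fin (d + 2) → (Fin d → ℤ), ∃ (i : Fin (d + 2)) (j : Fin (d + 1)),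
      ¬ Submodule.span ℝ (Set.range (phi ∘ t)) = ⊤ →
      Submodule.span ℝ (Set.range (phi ∘ t ∘ i.succAbove ∘ j.succAbove)) =
        Submodule.span ℝ (Set.range (phi ∘ t)) := by
    intro t
    by_cases h : Submodule.span ℝ (Set.range (phi ∘ t)) = ⊤
    · exact ⟨0, 0, fun h' => absurd h h'⟩
    · have hlt : finrank ℝ (Submodule.span ℝ (Set.range (phi ∘ t))) < d + 1 := by
        rw [← finrank_VV d]
        exact Submodule.finrank_lt h
      obtain ⟨i, hi⟩ := remove_one (phi ∘ t) (by omega)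
      obtain ⟨j, hj⟩ := remove_one ((phi ∘ t) ∘ i.succAbove) (by rw [hi]; omega)
      exact ⟨i, j, fun _ => by rw [← hi, ← hj]; rfl⟩
  choose f g hfg using hex
  let Dg : (Fin d → (Fin d → ℤ)) → Finset (Fin d → ℤ) := fun u =>
    (Sph phi Qf (Gr d n) (fit u)).filter (fun p => phi p ∈ Submodule.span ℝ (Set.range (phi ∘ u)))
  have hDg : ∀ u, #(Dg u) ≤ 2 * n ^ (d - 2) := by
    intro u
    apply hyper_card hd
    intro htop
    have h := finrank_range_le_card (R := ℝ) (phi ∘ u)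
    rw [Set.finrank, htop, finrank_top, finrank_VV, Fintype.card_fin] at h
    omega
  have hT : #((univ : Finset (Fin (d + 2))) ×ˢ ((univ : Finset (Fin (d + 1))) ×ˢ
      (Fintype.piFinset (fun _ : Fin d => Gr d n)).sigma (fun u => Dg u ×ˢ Dg u))) ≤
      (d + 2) * ((d + 1) * ((n ^ d) ^ d * (2 * n ^ (d - 2)) ^ 2)) := by
    rw [card_product, card_product, card_sigma, card_univ, card_univ, Fintype.card_fin, Fintype.card_fin]
    gcongr
    refine (sum_le_card_nsmul _ _ ((2 * n ^ (d - 2)) ^ 2) ?_).trans ?_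
    · intro u _
      rw [card_product, sq]
      exact Nat.mul_le_mul (hDg u) (hDg u)
    · rw [Fintype.card_piFinset_const, card_Gr, smul_eq_mul]
  refine le_trans ?_ hT
  refine card_le_card_of_injOn (fun t => (f t, g t, ⟨t ∘ (f t).succAbove ∘ (g t).succAbove,
    (t (f t), t ((f t).succAbove (g t)))⟩)) ?_ ?_
  · intro t ht
    rw [mem_coe, mem_filter, Tup, mem_filter, Fintype.mem_piFinset] at ht
    obtain ⟨⟨htG, l, hl⟩, hsp⟩ := ht
    have hq := hfg t hsp
    have hfit := fit_spec (t ∘ (f t).succAbove ∘ (g t).succAbove) ⟨l, fun i => hl _⟩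
    have hmem : ∀ i, t i ∈ Dg (t ∘ (f t).succAbove ∘ (g t).succAbove) := by
      intro i
      have hin : phi (t i) ∈ Submodule.span ℝ
          (Set.range (phi ∘ t ∘ (f t).succAbove ∘ (g t).succAbove)) := by
        rw [hq]
        exact Submodule.subset_span ⟨i, rfl⟩
      have heq : Set.EqOn l (fit (t ∘ (f t).succAbove ∘ (g t).succAbove))
          (Set.range (phi ∘ t ∘ (f t).succAbove ∘ (g t).succAbove)) := by
        rintro _ ⟨j, rfl⟩
        exact (hl _).symm.trans (hfit j)
      refine mem_filter.2 ⟨mem_Sph.2 ⟨htG i, ?_⟩, hin⟩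
      rw [hl i]
      exact LinearMap.eqOn_span heq hin
    rw [mem_coe, mem_product, mem_product, mem_sigma]
    refine ⟨mem_univ _, mem_univ _, Fintype.mem_piFinset.2 (fun j => htG _), ?_⟩
    rw [mem_product]
    exact ⟨hmem _, hmem _⟩
  · intro s _ t _ hst
    simp only [Prod.mk.injEq, Sigma.mk.injEq, heq_eq_eq] at hst
    obtain ⟨h1, h2, h3, h4, h5⟩ := hst
    rw [h1, h2] at h3 h5
    rw [h1] at h4
    exact tuple_ext (f t) (tuple_ext (g t) h3 h5) h4

theorem tup_count {d n t' : ℕ} (hd : 2 ≤ d) (hn : 1 ≤ n) (ht : t' + 1 ≤ d) (M : ℕ) (hM1 : 1 ≤ M)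
    (hM : ∀ l : VV d →ₗ[ℝ] ℝ, ∀ k < t' + 1, ∀ u : Fin k → (Fin d → ℤ), LinearIndependent ℝ (phi ∘ u) →
      (∀ i, u i ∈ Sph phi Qf (Gr d n) l) →
      #((Sph phi Qf (Gr d n) l).filter (fun p => phi p ∈ Submodule.span ℝ (Set.range (phi ∘ u)))) ≤ M) :
    #(Tup d n) ≤ (d + 2) * ((Nat.log 2 (n ^ d) + 1) * (2 * ((2 * 20 ^ d * (4 ^ (t' + 1) *
      10 ^ (d * t') * 2 ^ (d * t') *
      (Fintype.card (Fin (d - t') ⊕ Fin (t' + 1) ≃ Fin (d + 1))) + 1)) * M *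
      n ^ (d - 1 - t') * n ^ (d ^ 2 + d)))) +
      (d + 2) * ((d + 1) * ((n ^ d) ^ d * (2 * n ^ (d - 2)) ^ 2)) := by
  rw [← card_filter_add_card_filter_not (s := Tup d n)
    (fun t => Submodule.span ℝ (Set.range (phi ∘ t)) = ⊤)]
  refine add_le_add ((nondeg_count d n).trans ?_) (deg_count n hd)
  exact Nat.mul_le_mul_left _ (total_bound hd hn ht M hM1 hM fit (fun q hq => fit_indep q hq))

end Reduction


section Final
open Finset Module Filter Topology
open scoped Classical

theorem count_le_tup (d n : ℕ) : conSphericalCount n d ≤ #(Tup d n) := by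
  rw [conSphericalCount, ← Set.ncard_coe_finset]
  have hfl : ∀ x ∈ grid d n, ∀ j, ((⌊x j⌋ : ℤ) : ℝ) = x j ∧ 1 ≤ ⌊x j⌋ ∧ ⌊x j⌋ ≤ n := by
    intro x hx j
    obtain ⟨m, h1, h2, h3⟩ := hx j
    rw [h3]
    simp
    omega
  refine Set.ncard_le_ncard_of_injOn (fun t i j => ⌊t i j⌋) ?_ ?_ (Finset.finite_toSet _)
  · rintro t ⟨htg, c, ρ, hρ, ht⟩
    rw [mem_coe, Tup, mem_filter, Fintype.mem_piFinset]
    refine ⟨fun i => mem_Gr.2 (fun j => (hfl _ (htg i) j).2), ?_⟩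
    refine ⟨(ρ ^ 2 - ∑ j, c j ^ 2) • LinearMap.fst ℝ ℝ (Fin d → ℝ) +
      (∑ j, (2 * c j) • (LinearMap.proj j : (Fin d → ℝ) →ₗ[ℝ] ℝ)) ∘ₗ LinearMap.snd ℝ ℝ (Fin d → ℝ), ?_⟩
    intro i
    have h1 := ht i
    rw [Metric.mem_sphere, EuclideanSpace.dist_eq] at h1
    have h2 : ∑ j, dist (t i j) (c j) ^ 2 = ρ ^ 2 := by
      rw [← h1, Real.sq_sqrt (sum_nonneg (fun _ _ => sq_nonneg _))]
    simp only [Real.dist_eq, sq_abs] at h2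
    have h3 : ∀ j, ((⌊t i j⌋ : ℤ) : ℝ) = t i j := fun j => (hfl _ (htg i) j).1
    simp only [Qf, phi, h3, LinearMap.add_apply, LinearMap.smul_apply, LinearMap.fst_apply,
      LinearMap.comp_apply, LinearMap.snd_apply, LinearMap.sum_apply, LinearMap.proj_apply,
      smul_eq_mul, mul_one]
    rw [← h2, ← sum_sub_distrib, ← sum_add_distrib]
    refine sum_congr rfl ?_
    intro j _; ring
  · rintro s ⟨hs, -⟩ t ⟨ht, -⟩ hst
    funext i
    ext j
    have h1 := congrFun (congrFun hst i) j
    simp only at h1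
    rw [← (hfl _ (hs i) j).1, ← (hfl _ (ht i) j).1, h1]

theorem log_bound {d n : ℕ} (hn : 3 ≤ n) :
    ((Nat.log 2 (n ^ d) + 1 : ℕ) : ℝ) ≤ (2 * d + 1) * Real.log n := by
  have h1 : 1 ≤ Real.log n := by
    rw [Real.le_log_iff_exp_le (by positivity)]
    have := Real.exp_one_lt_d9
    have h3 : (3 : ℝ) ≤ n := by exact_mod_cast hn
    linarith
  have h2 := Real.natLog_le_logb (n ^ d) 2
  rw [Real.logb, Nat.cast_pow, Real.log_pow] at h2
  have hl2 := Real.log_two_gt_d9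
  have h4 : (d : ℝ) * Real.log n / Real.log ((2 : ℕ) : ℝ) ≤ 2 * d * Real.log n := by
    rw [Nat.cast_ofNat, div_le_iff₀ (by linarith)]
    have : 0 ≤ (d : ℝ) * Real.log n := by positivity
    nlinarith
  push_cast
  linarith

theorem log_eventually : ∀ᶠ n : ℕ in atTop,
    Real.log n ≤ Real.exp (Real.log n / Real.log (Real.log n)) := by
  have h1 : ∀ᶠ x : ℝ in atTop, Real.log x ^ 2 ≤ x := by
    have := (Real.isLittleO_pow_log_id_atTop (n := 2)).bound (c := 1) one_pos
    filter_upwards [this, eventually_ge_atTop 0] with x hx hx0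
    simpa [abs_of_nonneg hx0] using hx
  have h2 : Tendsto (fun n : ℕ => Real.log (n : ℝ)) atTop atTop :=
    Real.tendsto_log_atTop.comp tendsto_natCast_atTop_atTop
  filter_upwards [h2.eventually h1, h2.eventually (eventually_gt_atTop 1)] with n hn hn1
  have hl : 0 < Real.log (Real.log n) := Real.log_pos hn1
  rw [← Real.log_le_iff_le_exp (by linarith), le_div_iff₀ hl, ← sq]
  exact hn

theorem rpow_form {d n : ℕ} (hd : 3 ≤ d) (hn : 0 < n) :
    (n : ℝ) ^ ((d : ℝ) ^ 2 + 2 * (d : ℝ) - 4 + 43 / Real.log (Real.log n)) =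
      (n : ℝ) ^ (d ^ 2 + 2 * d - 4) * Real.exp (43 * (Real.log n / Real.log (Real.log n))) := by
  have hn' : (0 : ℝ) < n := by exact_mod_cast hn
  rw [Real.rpow_add hn']
  congr 1
  · rw [← Real.rpow_natCast (n : ℝ) (d ^ 2 + 2 * d - 4), Nat.cast_sub (by nlinarith)]
    push_cast
    rfl
  · rw [Real.rpow_def_of_pos hn']
    congr 1
    ring

theorem final_three {n K1 K2 : ℕ} (hn : 3 ≤ n) (T : ℕ)
    (h : T ≤ K1 * (Nat.log 2 (n ^ 3) + 1) * n ^ 12 + K2 * n ^ 11) :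
    (T : ℝ) ≤ (7 * K1 + K2 : ℕ) * ((n : ℝ) ^ 12 * Real.log n) := by
  have h1 : 1 ≤ Real.log n := by
    rw [Real.le_log_iff_exp_le (by positivity)]
    have := Real.exp_one_lt_d9
    have h3 : (3 : ℝ) ≤ n := by exact_mod_cast hn
    linarith
  have h2 := log_bound (d := 3) hn
  have h3 : (T : ℝ) ≤ K1 * ((Nat.log 2 (n ^ 3) + 1 : ℕ) : ℝ) * n ^ 12 + K2 * n ^ 11 := by
    exact_mod_cast h
  have hn1 : (1 : ℝ) ≤ n := by exact_mod_cast (by omega : 1 ≤ n)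
  calc (T : ℝ) ≤ _ := h3
    _ ≤ K1 * ((2 * (3 : ℕ) + 1) * Real.log n) * n ^ 12 + K2 * (n ^ 12 * Real.log n) := by
      gcongr
      calc (n : ℝ) ^ 11 = n ^ 11 * 1 := by ring
        _ ≤ n ^ 12 * Real.log n := by
          gcongr
          norm_num
    _ = _ := by push_cast; ring

theorem final_ge {d n K1 K2 M e : ℕ} (hn : 3 ≤ n) (T : ℕ)
    (hlog : Real.log n ≤ Real.exp (Real.log n / Real.log (Real.log n)))
    (hpos : 0 ≤ Real.log n / Real.log (Real.log n))
    (hM : (M : ℝ) ≤ 10 * Real.exp (42 * (Real.log n / Real.log (Real.log n))))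
    (h : T ≤ K1 * (Nat.log 2 (n ^ d) + 1) * M * n ^ e + K2 * n ^ e) :
    (T : ℝ) ≤ (10 * (2 * d + 1) * K1 + K2 : ℕ) *
      ((n : ℝ) ^ e * Real.exp (43 * (Real.log n / Real.log (Real.log n)))) := by
  have h2 := log_bound (d := d) hn
  have h3 : (T : ℝ) ≤ K1 * ((Nat.log 2 (n ^ d) + 1 : ℕ) : ℝ) * M * n ^ e + K2 * n ^ e := by
    exact_mod_cast h
  set y := Real.log n / Real.log (Real.log n) with hy
  have h43 : Real.exp (43 * y) = Real.exp y * Real.exp (42 * y) := by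
    rw [← Real.exp_add]; congr 1; ring
  have h1 : 1 ≤ Real.exp (43 * y) := Real.one_le_exp (by positivity)
  have hl0 : 0 ≤ Real.log n := Real.log_natCast_nonneg n
  calc (T : ℝ) ≤ _ := h3
    _ ≤ K1 * ((2 * d + 1) * Real.exp y) * (10 * Real.exp (42 * y)) * n ^ e +
        K2 * (n ^ e * Real.exp (43 * y)) := by
      gcongr
      · exact h2.trans (by gcongr)
      · exact le_mul_of_one_le_right (by positivity) h1
    _ = _ := by rw [h43]; push_cast; ring

end Final

theorem conspherical_tuples_upper_bound :
    ∃ c : ℝ, 0 < c ∧ ∀ d : ℕ, 3 ≤ d → ∃ C : ℝ, 0 < C ∧ ∃ N : ℕ, ∀ n ≥ N,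
      (conSphericalCount n d : ℝ) ≤
        C * ((n : ℝ) ^ ((d : ℝ) ^ 2 + 2 * (d : ℝ) - 4 + c / Real.log (Real.log n))
          + (n : ℝ) ^ (d ^ 2 + d) * Real.log n) := by
  refine ⟨43, by norm_num, ?_⟩
  intro d hd
  rcases Nat.eq_or_lt_of_le hd with h3 | h4
  · subst h3
    set K := (2 * 20 ^ 3 * (4 ^ (2 + 1) * 10 ^ (3 * 2) * 2 ^ (3 * 2) *
      (Fintype.card (Fin (3 - 2) ⊕ Fin (2 + 1) ≃ Fin (3 + 1))) + 1)) with hK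
    refine ⟨((7 * (20 * K) + 80 : ℕ) : ℝ), by positivity, 3, ?_⟩
    intro n hn
    have h1 := tup_count (d := 3) (n := n) (t' := 2) (by norm_num) (by omega) (by norm_num) 2 (by norm_num)
      (fun l k hk u _ hu => small_span _ l k hk u hu)
    rw [← hK] at h1
    have h2 := final_three (K1 := 20 * K) (K2 := 80) hn (conSphericalCount n 3)
      ((count_le_tup 3 n).trans (h1.trans (le_of_eq (by
        generalize K = K', Nat.log 2 (n ^ 3) = lg
        norm_num
        ring))))
    refine h2.trans ?_
    refine mul_le_mul_of_nonneg_left ?_ (by positivity)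
    have : 0 ≤ (n : ℝ) ^ (((3 : ℕ) : ℝ) ^ 2 + 2 * ((3 : ℕ) : ℝ) - 4 + 43 / Real.log (Real.log n)) := by
      positivity
    norm_num at this ⊢
    linarith
  · set K := (2 * 20 ^ d * (4 ^ (3 + 1) * 10 ^ (d * 3) * 2 ^ (d * 3) *
      (Fintype.card (Fin (d - 3) ⊕ Fin (3 + 1) ≃ Fin (d + 1))) + 1)) with hK
    have hev : ∀ᶠ n : ℕ in Filter.atTop, (conSphericalCount n d : ℝ) ≤
        ((10 * (2 * d + 1) * ((d + 2) * 2 * K) + (d + 2) * (d + 1) * 4 : ℕ) : ℝ) *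
        ((n : ℝ) ^ ((d : ℝ) ^ 2 + 2 * (d : ℝ) - 4 + 43 / Real.log (Real.log n))
          + (n : ℝ) ^ (d ^ 2 + d) * Real.log n) := by
      filter_upwards [divisor_bound, log_eventually, Filter.eventually_ge_atTop 3,
        Filter.eventually_ge_atTop (d ^ 4)] with n hdiv hlog hn hnd
      have hl1 : 1 ≤ Real.log n := by
        rw [Real.le_log_iff_exp_le (by positivity)]
        have := Real.exp_one_lt_d9
        have h3 : (3 : ℝ) ≤ n := by exact_mod_cast hn
        linarith
      have hpos : 0 ≤ Real.log n / Real.log (Real.log n) :=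
        div_nonneg (by linarith) (Real.log_nonneg hl1)
      set M := ⌊10 * Real.exp (42 * (Real.log n / Real.log (Real.log n)))⌋₊ with hMdef
      have hMle : (M : ℝ) ≤ 10 * Real.exp (42 * (Real.log n / Real.log (Real.log n))) :=
        Nat.floor_le (by positivity)
      have hM2 : 2 ≤ M := by
        rw [hMdef]
        apply Nat.le_floor
        have : 1 ≤ Real.exp (42 * (Real.log n / Real.log (Real.log n))) :=
          Real.one_le_exp (by positivity)
        push_cast
        linarith
      have h1 := tup_count (d := d) (n := n) (t' := 3) (by omega) (by omega) (by omega) M (by omega) (by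
        intro l k hk u hu1 hu2
        rcases Nat.lt_or_ge k 3 with hk3 | hk3
        · exact (small_span _ l k hk3 u hu2).trans hM2
        · obtain rfl : k = 3 := by omega
          obtain ⟨m, hm0, hm1, hm2⟩ := circle_card l u hu1 hu2
          refine hm2.trans (Nat.le_floor ?_)
          have hm9 : m ≤ n ^ 9 := by
            refine hm1.trans ?_
            calc (d * n ^ 2) ^ 4 = d ^ 4 * n ^ 8 := by ring
              _ ≤ n * n ^ 8 := Nat.mul_le_mul_right _ hnd
              _ = n ^ 9 := by ring
          have hτ := hdiv m hm0 hm9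
          push_cast
          calc (10 : ℝ) * (m.divisors.card : ℝ) ^ 3 ≤
              10 * (Real.exp (14 * (Real.log n / Real.log (Real.log n)))) ^ 3 := by gcongr
            _ = _ := by
              rw [← Real.exp_nat_mul]
              congr 2
              push_cast
              ring)
      rw [← hK] at h1
      have hT : conSphericalCount n d ≤ ((d + 2) * 2 * K) * (Nat.log 2 (n ^ d) + 1) * M *
          n ^ (d ^ 2 + 2 * d - 4) + ((d + 2) * (d + 1) * 4) * n ^ (d ^ 2 + 2 * d - 4) := by
        refine (count_le_tup d n).trans (h1.trans (le_of_eq ?_))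
        have e1 : n ^ (d ^ 2 + 2 * d - 4) = n ^ (d - 1 - 3) * n ^ (d ^ 2 + d) := by
          rw [← pow_add]; congr 1; omega
        have e2 : n ^ (d ^ 2 + 2 * d - 4) = (n ^ d) ^ d * (n ^ (d - 2)) ^ 2 := by
          rw [← pow_mul, ← pow_mul, ← pow_add, ← sq]; congr 1; omega
        congr 1
        · rw [e1]; ring
        · rw [e2]; ring
      have h2 := final_ge hn _ hlog hpos hMle hT
      refine h2.trans ?_
      refine mul_le_mul_of_nonneg_left ?_ (by positivity)
      rw [rpow_form hd (by omega)]
      have : 0 ≤ (n : ℝ) ^ (d ^ 2 + d) * Real.log n := by positivity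
      linarith
    obtain ⟨N, hN⟩ := Filter.eventually_atTop.1 hev
    exact ⟨_, by positivity, N, hN⟩
end

section
/- There exists a constant c > 0 such that for every integer d ≥ 3 there exist a constant c' > 0 and N ∈ ℕ with the following property: for every n ≥ N there is a subset S of [n]^d with |S| ≥ c' · n^{min{d,4}/(d+1) − c/log log n} such that no d + 2 points of S lie on a common (d−1)-sphere in ℝ^d and no d + 2 points of S lie on a common affine hyperplane of ℝ^d. -/
/-- A curve `x : K → K^d` with `|x(t)|² = t^(d+1)` and whose coordinates, together with `1`,
span all the monomials `t^k`, `k ≤ d`. -/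
def GoodCurve (K : Type) [Field K] (d : ℕ) (x : Fin d → K → K) : Prop :=
  (∀ t, ∑ i, x i t ^ 2 = t ^ (d + 1)) ∧
  ∀ k ≤ d, ∃ (a₀ : K) (a : Fin d → K), ∀ t, t ^ k = a₀ + ∑ i, a i * x i t

section Curves
variable {K : Type} [Field K]

lemma good_one : ∃ x, GoodCurve K 1 x := by
  refine ⟨fun _ t => t, fun t => by simp, ?_⟩
  intro k hk
  interval_cases k
  · exact ⟨1, 0, fun t => by simp⟩
  · exact ⟨0, fun _ => 1, fun t => by simp⟩

lemma good_three (h2 : (2 : K) ≠ 0) (α β : K) (hab : α ^ 2 + β ^ 2 = -1)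
    : ∃ x, GoodCurve K 3 x := by
  -- u = t, v = -t^3/2, w = t^2
  refine ⟨![fun t => α * (t - t ^ 3 / 2) - β * t ^ 2, fun t => β * (t - t ^ 3 / 2) + α * t ^ 2,
    fun t => t + t ^ 3 / 2], fun t => ?_, ?_⟩
  · simp only [Fin.sum_univ_succ, Fin.sum_univ_zero, Matrix.cons_val_zero, Matrix.cons_val_succ]
    field_simp
    linear_combination ((2*t - t ^ 3)^2 + 4 * t ^ 4) * hab
  · intro k hk
    interval_cases k
    · exact ⟨1, 0, fun t => by simp⟩
    · refine ⟨0, ![-α / 2, -β / 2, 1 / 2], fun t => ?_⟩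
      simp only [Fin.sum_univ_succ, Fin.sum_univ_zero, Matrix.cons_val_zero, Matrix.cons_val_succ]
      field_simp
      linear_combination (2 * t - t ^ 3) * hab
    · refine ⟨0, ![β, -α, 0], fun t => ?_⟩
      simp only [Fin.sum_univ_succ, Fin.sum_univ_zero, Matrix.cons_val_zero, Matrix.cons_val_succ]
      field_simp
      linear_combination (2 * t ^ 2) * hab
    · refine ⟨0, ![α, β, 1], fun t => ?_⟩
      simp only [Fin.sum_univ_succ, Fin.sum_univ_zero, Matrix.cons_val_zero, Matrix.cons_val_succ]
      field_simp
      linear_combination (-(2 * t - t ^ 3)) * hab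

/-- Adding two hyperbolic planes. -/
lemma add_planes (h2 : (2 : K) ≠ 0) (α β : K) (hab : α ^ 2 + β ^ 2 = -1)
    {d : ℕ} (y : Fin d → K → K) (u₁ v₁ u₂ v₂ : K → K) :
    ∃ x : Fin (d + 4) → K → K,
      (∀ t, ∑ i, x i t ^ 2 = ∑ i, y i t ^ 2 + u₁ t * v₁ t + u₂ t * v₂ t) ∧
      ∀ (a : Fin d → K) (b₁ c₁ b₂ c₂ : K), ∃ a' : Fin (d + 4) → K, ∀ t,
        ∑ i, a' i * x i t =
          ∑ i, a i * y i t + b₁ * u₁ t + c₁ * v₁ t + b₂ * u₂ t + c₂ * v₂ t := by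
  refine ⟨Fin.cons (fun t => α * (u₁ t - v₁ t / 4) - β * (u₂ t - v₂ t / 4))
    (Fin.cons (fun t => β * (u₁ t - v₁ t / 4) + α * (u₂ t - v₂ t / 4))
    (Fin.cons (fun t => u₁ t + v₁ t / 4) (Fin.cons (fun t => u₂ t + v₂ t / 4) y))),
    fun t => ?_, ?_⟩
  · have h4 : (4 : K) ≠ 0 := by
      have : (4 : K) = 2 * 2 := by norm_num
      rw [this]; exact mul_ne_zero h2 h2
    simp only [Fin.sum_univ_succ (n := d + 3), Fin.sum_univ_succ (n := d + 2),
      Fin.sum_univ_succ (n := d + 1), Fin.sum_univ_succ (n := d), Fin.cons_zero, Fin.cons_succ]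
    field_simp
    linear_combination ((4 * u₁ t - v₁ t) ^ 2 + (4 * u₂ t - v₂ t) ^ 2) * hab
  · intro a b₁ c₁ b₂ c₂
    have h4 : (4 : K) ≠ 0 := by
      have : (4 : K) = 2 * 2 := by norm_num
      rw [this]; exact mul_ne_zero h2 h2
    -- p q = coefficients for s = u - v/4 and r = u + v/4: b u + c v
    refine ⟨Fin.cons (-α * (b₁ / 2 - 2 * c₁) + β * (b₂ / 2 - 2 * c₂))
      (Fin.cons (-β * (b₁ / 2 - 2 * c₁) - α * (b₂ / 2 - 2 * c₂))
      (Fin.cons (b₁ / 2 + 2 * c₁) (Fin.cons (b₂ / 2 + 2 * c₂) a))), fun t => ?_⟩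
    simp only [Fin.sum_univ_succ (n := d + 3), Fin.sum_univ_succ (n := d + 2),
      Fin.sum_univ_succ (n := d + 1), Fin.sum_univ_succ (n := d), Fin.cons_zero, Fin.cons_succ]
    field_simp
    linear_combination (-(b₁ - 4 * c₁) * (4 * u₁ t - v₁ t)
      - (b₂ - 4 * c₂) * (4 * u₂ t - v₂ t)) * hab

lemma good_four (h2 : (2 : K) ≠ 0) (α β : K) (hab : α ^ 2 + β ^ 2 = -1)
    : ∃ x, GoodCurve K 4 x := by
  obtain ⟨x, hx, hs⟩ := add_planes h2 α β hab (d := 0) Fin.elim0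
    (fun t => t) (fun t => 2 * t ^ 4) (fun t => t ^ 2) (fun t => - t ^ 3)
  refine ⟨x, fun t => ?_, ?_⟩
  · rw [hx]; simp; ring
  intro k hk
  have key : ∀ (b₁ c₁ b₂ c₂ : K), (∀ t : K, t ^ k =
      b₁ * t + c₁ * (2 * t ^ 4) + b₂ * t ^ 2 + c₂ * (-t ^ 3)) →
      ∃ (a₀ : K) (a : Fin 4 → K), ∀ t, t ^ k = a₀ + ∑ i, a i * x i t := by
    intro b₁ c₁ b₂ c₂ h
    obtain ⟨a', ha'⟩ := hs Fin.elim0 b₁ c₁ b₂ c₂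
    refine ⟨0, a', fun t => ?_⟩
    rw [h, zero_add]
    refine Eq.trans ?_ (ha' t).symm
    simp
  interval_cases k
  · exact ⟨1, 0, fun t => by simp⟩
  · exact key 1 0 0 0 (fun t => by ring)
  · exact key 0 0 1 0 (fun t => by ring)
  · exact key 0 0 0 (-1) (fun t => by ring)
  · exact key 0 (1/2) 0 0 (fun t => by field_simp; ring)

lemma good_six (h2 : (2 : K) ≠ 0) (α β : K) (hab : α ^ 2 + β ^ 2 = -1)
    : ∃ x, GoodCurve K 6 x := by
  obtain ⟨x, hx, hs⟩ := add_planes h2 α β hab (d := 2) ![fun t => t ^ 3, fun t => t ^ 4]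
    (fun t => t ^ 2) (fun t => t ^ 5 - t ^ 6) (fun t => t) (fun t => - t ^ 5)
  refine ⟨x, fun t => ?_, ?_⟩
  · rw [hx]; simp; ring
  intro k hk
  have key : ∀ (e f b₁ c₁ b₂ c₂ : K), (∀ t : K, t ^ k = e * t ^ 3 + f * t ^ 4 +
      b₁ * t ^ 2 + c₁ * (t ^ 5 - t ^ 6) + b₂ * t + c₂ * (-t ^ 5)) →
      ∃ (a₀ : K) (a : Fin 6 → K), ∀ t, t ^ k = a₀ + ∑ i, a i * x i t := by
    intro e f b₁ c₁ b₂ c₂ h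
    obtain ⟨a', ha'⟩ := hs ![e, f] b₁ c₁ b₂ c₂
    refine ⟨0, a', fun t => ?_⟩
    rw [h, zero_add]
    refine Eq.trans ?_ (ha' t).symm
    simp
  interval_cases k
  · exact ⟨1, 0, fun t => by simp⟩
  · exact key 0 0 0 0 1 0 (fun t => by ring)
  · exact key 0 0 1 0 0 0 (fun t => by ring)
  · exact key 1 0 0 0 0 0 (fun t => by ring)
  · exact key 0 1 0 0 0 0 (fun t => by ring)
  · exact key 0 0 0 0 0 (-1) (fun t => by ring)
  · exact key 0 0 0 (-1) 0 (-1) (fun t => by ring)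

lemma good_step (h2 : (2 : K) ≠ 0) (α β : K) (hab : α ^ 2 + β ^ 2 = -1)
    {d : ℕ} (h : ∃ y, GoodCurve K d y) : ∃ x, GoodCurve K (d + 4) x := by
  obtain ⟨y, hy, hys⟩ := h
  obtain ⟨x, hx, hs⟩ := add_planes h2 α β hab (fun i t => t ^ 2 * y i t)
    (fun t => t) (fun t => t ^ (d + 4)) (fun t => t ^ 2) (fun t => - t ^ (d + 3))
  refine ⟨x, fun t => ?_, ?_⟩
  · rw [hx]
    have : ∑ i, (t ^ 2 * y i t) ^ 2 = t ^ 4 * t ^ (d + 1) := by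
      rw [← hy, Finset.mul_sum]
      exact Finset.sum_congr rfl fun i _ => by ring
    rw [this]; ring
  intro k hk
  have key : ∀ (a : Fin d → K) (b₁ c₁ b₂ c₂ : K), (∀ t : K, t ^ k =
      ∑ i, a i * (t ^ 2 * y i t) +
      b₁ * t + c₁ * t ^ (d + 4) + b₂ * t ^ 2 + c₂ * (-t ^ (d + 3))) →
      ∃ (a₀ : K) (a : Fin (d + 4) → K), ∀ t, t ^ k = a₀ + ∑ i, a i * x i t := by
    intro a b₁ c₁ b₂ c₂ h
    obtain ⟨a', ha'⟩ := hs a b₁ c₁ b₂ c₂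
    exact ⟨0, a', fun t => by rw [h, zero_add, ha' t]⟩
  rcases Nat.lt_or_ge k 2 with h | h
  · interval_cases k
    · exact ⟨1, 0, fun t => by simp⟩
    · exact key 0 1 0 0 0 (fun t => by simp)
  rcases Nat.lt_or_ge (d + 2) k with h' | h'
  · have : k = d + 3 ∨ k = d + 4 := by omega
    rcases this with rfl | rfl
    · exact key 0 0 0 0 (-1) (fun t => by simp)
    · exact key 0 0 1 0 0 (fun t => by simp)
  · obtain ⟨k, rfl⟩ := Nat.exists_eq_add_of_le h
    obtain ⟨a₀, a, ha⟩ := hys k (by omega)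
    refine key a 0 0 a₀ 0 (fun t => ?_)
    rw [pow_add, ha t, mul_add, Finset.mul_sum]
    have : ∀ i, t ^ 2 * (a i * y i t) = a i * (t ^ 2 * y i t) := fun i => by ring
    simp only [this]
    ring

lemma good_all (h2 : (2 : K) ≠ 0) (α β : K) (hab : α ^ 2 + β ^ 2 = -1)
    (m : ℕ) : (∃ x, GoodCurve K (4 * m + 5) x) ∧ (∃ x, GoodCurve K (4 * m + 3) x) ∧
    (∃ x, GoodCurve K (4 * m + 4) x) ∧ (∃ x, GoodCurve K (4 * m + 6) x) := by
  induction m with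
  | zero => exact ⟨good_step h2 α β hab good_one, good_three h2 α β hab, good_four h2 α β hab,
      good_six h2 α β hab⟩
  | succ m ih =>
    obtain ⟨a, b, c, e⟩ := ih
    exact ⟨good_step h2 α β hab a, good_step h2 α β hab b, good_step h2 α β hab c,
      good_step h2 α β hab e⟩

lemma good_exists (h2 : (2 : K) ≠ 0) (α β : K) (hab : α ^ 2 + β ^ 2 = -1)
    {d : ℕ} (hd : 3 ≤ d) : ∃ x, GoodCurve K d x := by
  obtain ⟨a, b, c, e⟩ := good_all h2 α β hab ((d - 3) / 4)
  have : d = 4 * ((d - 3) / 4) + 5 ∨ d = 4 * ((d - 3) / 4) + 3 ∨ d = 4 * ((d - 3) / 4) + 4 ∨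
    d = 4 * ((d - 3) / 4) + 6 := by omega
  rcases this with h | h | h | h <;> rw [h] <;> assumption

end Curves

/-- No nontrivial linear relation among `d + 2` lifted points of a good curve. -/
lemma good_indep {K : Type} [Field K] {d : ℕ} {x : Fin d → K → K} (hx : GoodCurve K d x)
    (t : Fin (d + 2) → K) (ht : Function.Injective t) (l : Fin (d + 2) → K)
    (h0 : ∑ j, l j = 0) (hsq : ∑ j, l j * ∑ i, x i (t j) ^ 2 = 0)
    (hc : ∀ i, ∑ j, l j * x i (t j) = 0) : l = 0 := by
  have hpow : ∀ k : Fin (d + 2), ∑ j, l j * t j ^ (k : ℕ) = 0 := by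
    intro k
    rcases Nat.lt_or_ge d k with h | h
    · have : (k : ℕ) = d + 1 := by omega
      rw [this]
      simpa only [hx.1] using hsq
    · obtain ⟨a₀, a, ha⟩ := hx.2 k h
      simp only [ha, mul_add, Finset.sum_add_distrib, ← Finset.sum_mul, h0, zero_mul, zero_add,
        Finset.mul_sum]
      rw [Finset.sum_comm]
      refine Finset.sum_eq_zero fun i _ => ?_
      have : ∀ j, l j * (a i * x i (t j)) = a i * (l j * x i (t j)) := fun j => by ring
      simp only [this, ← Finset.mul_sum, hc, mul_zero]
  have hdet : (Matrix.vandermonde t).det ≠ 0 := Matrix.det_vandermonde_ne_zero_iff.2 ht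
  by_contra hl
  apply hdet
  rw [← Matrix.exists_vecMul_eq_zero_iff]
  refine ⟨l, hl, ?_⟩
  ext k
  simpa [Matrix.vecMul, dotProduct, Matrix.vandermonde_apply] using hpow k

/-- Key lemma: integer points reducing to the curve are in general position over `ℝ`. -/
lemma real_indep {p : ℕ} [Fact p.Prime] {d : ℕ} {x : Fin d → ZMod p → ZMod p}
    (hx : GoodCurve (ZMod p) d x)
    (t : Fin (d + 2) → ZMod p) (ht : Function.Injective t)
    (P : Fin (d + 2) → Fin d → ℤ) (hP : ∀ j i, (P j i : ZMod p) = x i (t j))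
    (a c : ℝ) (b : Fin d → ℝ)
    (h : ∀ j, a * ∑ i, (P j i : ℝ) ^ 2 + ∑ i, b i * (P j i : ℝ) + c = 0) :
    a = 0 ∧ b = 0 ∧ c = 0 := by
  let M : Matrix (Fin (d + 2)) (Fin (d + 2)) ℤ :=
    fun j => Fin.cons 1 (Fin.cons (∑ i, P j i ^ 2) (P j))
  by_contra hne
  have hR : (M.map (Int.cast : ℤ → ℝ)).det = 0 := by
    rw [← Matrix.exists_mulVec_eq_zero_iff]
    refine ⟨Fin.cons c (Fin.cons a b), fun hv => hne ?_, ?_⟩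
    · refine ⟨?_, ?_, ?_⟩
      · simpa using congrFun hv (Fin.succ 0)
      · ext i
        simpa using congrFun hv (Fin.succ (Fin.succ i))
      · simpa using congrFun hv 0
    · ext j
      have e : ∑ i, (P j i : ℝ) * b i = ∑ i, b i * (P j i : ℝ) :=
        Finset.sum_congr rfl fun i _ => mul_comm _ _
      change ∑ k, ((M j k : ℤ) : ℝ) * (Fin.cons c (Fin.cons a b) : Fin (d + 2) → ℝ) k = 0
      have h0 : M j 0 = 1 := rfl
      have h1 : M j (Fin.succ 0) = ∑ i, P j i ^ 2 := rfl
      have hs : ∀ i : Fin d, M j i.succ.succ = P j i := fun i => rfl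
      rw [Fin.sum_univ_succ, Fin.sum_univ_succ]
      simp only [h0, h1, hs, Fin.cons_zero, Fin.cons_succ, e]
      push_cast
      linarith [h j]
  have hZ : M.det = 0 := by
    have := (Int.castRingHom ℝ).map_det M
    have h' : (Int.castRingHom ℝ) M.det = 0 := this.trans hR
    simpa using h'
  have hp : (M.map (Int.cast : ℤ → ZMod p)).det = 0 := by
    have := (Int.castRingHom (ZMod p)).map_det M
    rw [hZ, map_zero] at this
    exact this.symm
  rw [← Matrix.exists_vecMul_eq_zero_iff] at hp
  obtain ⟨l, hl, hlM⟩ := hp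
  apply hl
  have hcol : ∀ k, ∑ j, l j * ((M j k : ℤ) : ZMod p) = 0 := fun k => congrFun hlM k
  refine good_indep hx t ht l ?_ ?_ ?_
  · simpa [M] using hcol 0
  · simpa [M, hP] using hcol (Fin.succ 0)
  · intro i
    simpa [M, hP] using hcol (Fin.succ (Fin.succ i))

/-- The lifted point set. -/
noncomputable def liftPt {p d : ℕ} (x : Fin d → ZMod p → ZMod p) (t : ZMod p) :
    EuclideanSpace ℝ (Fin d) :=
  WithLp.toLp 2 fun i => ((((x i t - 1).val + 1 : ℕ) : ℤ) : ℝ)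

lemma card_le_of_eq {p : ℕ} [Fact p.Prime] {d : ℕ} {x : Fin d → ZMod p → ZMod p}
    (hx : GoodCurve (ZMod p) d x) (B : Set (EuclideanSpace ℝ (Fin d)))
    (a c : ℝ) (b : Fin d → ℝ) (hne : ¬ (a = 0 ∧ b = 0 ∧ c = 0))
    (h : ∀ y ∈ B, a * ∑ i, (y i) ^ 2 + ∑ i, b i * y i + c = 0) :
    (Set.range (liftPt x) ∩ B).ncard ≤ d + 1 := by
  by_contra hcon
  push Not at hcon
  have hfin : (Set.range (liftPt x) ∩ B).Finite := (Set.finite_range _).inter_of_left _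
  obtain ⟨U, hU, hUc⟩ := Set.exists_subset_card_eq (s := Set.range (liftPt x) ∩ B) (n := d + 2) hcon
  have hUf : U.Finite := hfin.subset hU
  have e : Fin (d + 2) ≃ U := by
    have hcU : Nat.card U = d + 2 := by rw [← hUc]; rfl
    haveI : Finite U := hUf
    exact (Finite.equivFinOfCardEq hcU).symm
  have : ∀ j, ∃ t, liftPt x t = (e j : EuclideanSpace ℝ (Fin d)) := fun j => (hU (e j).2).1
  choose t ht using this
  have hinj : Function.Injective t := by
    intro j k hjk
    apply e.injective
    apply Subtype.ext
    rw [← ht, ← ht, hjk]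
  apply hne
  refine real_indep hx t hinj (fun j i => (((x i (t j) - 1).val + 1 : ℕ) : ℤ)) ?_ a c b ?_
  · intro j i
    simp
  · intro j
    have := h _ (hU (e j).2).2
    rw [← ht j] at this
    exact this

lemma liftPt_inj {p : ℕ} [Fact p.Prime] {d : ℕ} (hd : 3 ≤ d) {x : Fin d → ZMod p → ZMod p}
    (hx : GoodCurve (ZMod p) d x) : Function.Injective (liftPt x) := by
  intro s t hst
  have hc : ∀ i, x i s = x i t := by
    intro i
    have := congrArg (fun y : EuclideanSpace ℝ (Fin d) => y i) hst
    simp only [liftPt, Int.cast_inj, Nat.cast_inj, Nat.add_right_cancel_iff] at this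
    have := ZMod.val_injective p this
    simpa using this
  obtain ⟨a₀, a, ha⟩ := hx.2 1 (by omega)
  have h1 := ha s
  have h2 := ha t
  simp only [hc] at h1
  rw [← h2] at h1
  simpa using h1

theorem no_dplus2_on_a_sphere :
    ∃ c : ℝ, 0 < c ∧ ∀ d : ℕ, 3 ≤ d → ∃ c' : ℝ, 0 < c' ∧ ∃ N : ℕ, ∀ n ≥ N,
      ∃ S : Set (EuclideanSpace ℝ (Fin d)),
        S ⊆ grid d n ∧
        c' * (n : ℝ) ^ ((min d 4 : ℝ) / ((d : ℝ) + 1) - c / Real.log (Real.log n))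
          ≤ S.ncard ∧
        (∀ (c₀ : EuclideanSpace ℝ (Fin d)) (ρ : ℝ), 0 < ρ →
          (S ∩ Metric.sphere c₀ ρ).ncard ≤ d + 1) ∧
        (∀ A : AffineSubspace ℝ (EuclideanSpace ℝ (Fin d)),
          Module.finrank ℝ A.direction = d - 1 →
            (S ∩ (A : Set (EuclideanSpace ℝ (Fin d)))).ncard ≤ d + 1) := by
  refine ⟨1, one_pos, fun d hd => ⟨1 / 4, by norm_num, 9, fun n hn => ?_⟩⟩
  obtain ⟨p, hp, hp1, hp2⟩ := Nat.exists_prime_lt_and_le_two_mul (n / 2) (by omega)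
  have : Fact p.Prime := ⟨hp⟩
  have h2 : (2 : ZMod p) ≠ 0 := by
    intro h
    have : ((2 : ℕ) : ZMod p) = 0 := by exact_mod_cast h
    rw [ZMod.natCast_eq_zero_iff] at this
    have := Nat.le_of_dvd (by norm_num) this
    omega
  obtain ⟨α, β, hab⟩ := ZMod.sq_add_sq p (-1)
  obtain ⟨x, hx⟩ := good_exists h2 α β hab hd
  refine ⟨Set.range (liftPt x), ?_, ?_, ?_, ?_⟩
  · rintro _ ⟨t, rfl⟩ i
    refine ⟨(x i t - 1).val + 1, by omega, ?_, by simp [liftPt]⟩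
    have := ZMod.val_lt (x i t - 1)
    omega
  · have hcard : (Set.range (liftPt x)).ncard = p := by
      rw [← Set.image_univ, Set.ncard_image_of_injective _ (liftPt_inj hd hx), Set.ncard_univ,
        Nat.card_zmod]
    rw [hcard]
    have hn9 : (9 : ℝ) ≤ n := by exact_mod_cast hn
    have hlog : 1 ≤ Real.log n := by
      rw [Real.le_log_iff_exp_le (by linarith)]
      have := Real.exp_one_lt_d9
      linarith
    have hll : 0 ≤ Real.log (Real.log n) := Real.log_nonneg hlog
    have hexp : (min d 4 : ℝ) / ((d : ℝ) + 1) - 1 / Real.log (Real.log n) ≤ 1 := by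
      have h1 : (min d 4 : ℝ) / ((d : ℝ) + 1) ≤ 1 := by
        rw [div_le_one (by positivity)]
        have := min_le_left (d : ℝ) 4
        linarith
      have : 0 ≤ 1 / Real.log (Real.log n) := by positivity
      linarith
    have := Real.rpow_le_rpow_of_exponent_le (by linarith : (1 : ℝ) ≤ n) hexp
    rw [Real.rpow_one] at this
    have hpn : (n : ℝ) ≤ 2 * p := by
      have : n ≤ 2 * p := by omega
      exact_mod_cast this
    linarith
  · intro c₀ ρ hρ
    refine card_le_of_eq hx _ 1 (∑ i, c₀ i ^ 2 - ρ ^ 2) (fun i => -2 * c₀ i) (by simp) ?_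
    intro y hy
    rw [Metric.mem_sphere, dist_eq_norm] at hy
    have h1 := EuclideanSpace.real_norm_sq_eq (y - c₀)
    rw [hy] at h1
    rw [h1, one_mul, ← add_sub_assoc, ← Finset.sum_add_distrib, ← Finset.sum_add_distrib,
      ← Finset.sum_sub_distrib]
    refine Finset.sum_eq_zero fun i _ => ?_
    simp only [PiLp.sub_apply]
    ring
  · intro A hA
    rcases (A : Set (EuclideanSpace ℝ (Fin d))).eq_empty_or_nonempty with h | ⟨q, hq⟩
    · rw [h]; simp
    have hlt : A.direction ≠ ⊤ := by
      intro h
      rw [h, finrank_top, finrank_euclideanSpace_fin] at hA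
      omega
    have hperp : A.directionᗮ ≠ ⊥ := fun h => hlt (Submodule.orthogonal_eq_bot_iff.1 h)
    obtain ⟨b, hb, hb0⟩ := Submodule.exists_mem_ne_zero_of_ne_bot hperp
    refine card_le_of_eq hx _ 0 (-∑ i, b i * q i) (fun i => b i) ?_ ?_
    · rintro ⟨-, h, -⟩
      apply hb0
      ext i
      exact congrFun h i
    · intro y hy
      have hd' : y -ᵥ q ∈ A.direction := AffineSubspace.vsub_mem_direction hy hq
      have h0 := (Submodule.mem_orthogonal _ _).1 hb _ hd'
      rw [PiLp.inner_apply] at h0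
      simp only [vsub_eq_sub, PiLp.sub_apply, RCLike.inner_apply, conj_trivial, mul_sub,
        Finset.sum_sub_distrib] at h0
      linarith
end
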